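/- arXiv:2605.23233 — 5 statements merged into one kernel-verified Lean document; each statement's English description precedes it below -/
import Mathlib

section
/- There exists a constant C > 0 such that for every smooth compactly supported function f : ℝ³ → ℝ, ‖Z₃f‖_{L²} ≤ C · ‖f‖_{L²}^{3/4} · (‖f‖_{L²}² + ‖Z₃⁴f‖_{L²}²)^{1/8}. -/
open MeasureTheory

/-- Vertical partial derivative `∂₃`. -/
noncomputable def pd3 (f : (Fin 3 → ℝ) → ℝ) : (Fin 3 → ℝ) → ℝ :=
  fun x => fderiv ℝ f x (Pi.single 2 1)

/-- The conormal vector field `Z₃ f = (x₃/(1+x₃)) ∂₃ f`. -/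
noncomputable def Z3 (f : (Fin 3 → ℝ) → ℝ) : (Fin 3 → ℝ) → ℝ :=
  fun x => (x 2 / (1 + x 2)) * pd3 f x

/-- L² norm over the upper half-space `{x : x₃ > 0}` of ℝ³. -/
noncomputable def L2H (f : (Fin 3 → ℝ) → ℝ) : ℝ :=
  (eLpNorm f 2 (volume.restrict {x : Fin 3 → ℝ | 0 < x 2})).toReal

lemma alg (N0 N1 N2 N3 N4 : ℝ) (h0 : 0 ≤ N0) (h1 : 0 ≤ N1) (h2 : 0 ≤ N2) (h3 : 0 ≤ N3) (h4 : 0 ≤ N4)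
  (e1 : N1^2 ≤ N0*N2+N0*N1) (e2 : N2^2 ≤ N1*N3+N1*N2) (e3 : N3^2 ≤ N2*N4+N2*N3) :
  N1^4 ≤ 8^6 * (2 + 16*8^6) * (N0^3 * (N0+N4)) := by
  obtain ⟨B1, hB1⟩ : ∃ B1, B1 = N0 + N1 := ⟨_, rfl⟩
  obtain ⟨B2, hB2⟩ : ∃ B2, B2 = B1 + N2 := ⟨_, rfl⟩
  obtain ⟨B3, hB3⟩ : ∃ B3, B3 = B2 + N3 := ⟨_, rfl⟩
  obtain ⟨B4, hB4⟩ : ∃ B4, B4 = B3 + N4 := ⟨_, rfl⟩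
  have p1 : 0 ≤ B1 := by linarith
  have p2 : 0 ≤ B2 := by linarith
  have p3 : 0 ≤ B3 := by linarith
  have p4 : 0 ≤ B4 := by linarith
  have key : ∀ a x y n : ℝ, 0 ≤ a → 0 ≤ x → 0 ≤ y → 0 ≤ n → n ≤ a → x^2 ≤ n*y+n*x → 
      (a+x)^2 ≤ 8*(a*(a+x+y)) := by
    intro a x y n ha hx hy hn hna h
    have : x^2 ≤ a*y+a*x := by nlinarith
    nlinarith [mul_nonneg ha hx, mul_nonneg ha hy]
  have f1 : B1^2 ≤ 8*(N0*B2) := by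
    have := key N0 N1 N2 N0 h0 h1 h2 h0 le_rfl e1
    rw [hB2, hB1]; exact this
  have f2 : B2^2 ≤ 8*(B1*B3) := by
    have := key B1 N2 N3 N1 p1 h2 h3 h1 (by linarith) e2
    rw [hB3, hB2]; exact this
  have f3 : B3^2 ≤ 8*(B2*B4) := by
    have := key B2 N3 N4 N2 p2 h3 h4 h2 (by linarith) e3
    rw [hB4, hB3]; exact this
  clear key e1 e2 e3
  have hN : N1 ≤ B1 := by linarith
  rcases p1.eq_or_lt with hz | q1
  · have : N1 = 0 := by linarith
    rw [this, zero_pow (by norm_num)]; positivity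
  have q2 : 0 < B2 := by linarith
  have q3 : 0 < B3 := by linarith
  have q4 : 0 < B4 := by linarith
  have g2 : B2^4 ≤ 64*(B1^2*B3^2) := by
    calc B2^4 = (B2^2)^2 := by ring
      _ ≤ (8*(B1*B3))^2 := by gcongr
      _ = _ := by ring
  have g2a : B2^3 ≤ 8^3*(B1^2*B4) := by
    refine le_of_mul_le_mul_right ?_ q2
    calc B2^3*B2 = B2^4 := by ring
      _ ≤ 64*(B1^2*B3^2) := g2
      _ ≤ 64*(B1^2*(8*(B2*B4))) := by gcongr
      _ = _ := by ring
  have g2b : B2^3 ≤ 8^3*(N0*B3^2) := by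
    refine le_of_mul_le_mul_right ?_ q2
    calc B2^3*B2 = B2^4 := by ring
      _ ≤ 64*(B1^2*B3^2) := g2
      _ ≤ 64*((8*(N0*B2))*B3^2) := by gcongr
      _ = _ := by ring
  have k1 : B1^4 ≤ 8^6*(N0^3*B4) := by
    refine le_of_mul_le_mul_right ?_ (pow_pos q1 2)
    calc B1^4*B1^2 = (B1^2)^3 := by ring
      _ ≤ (8*(N0*B2))^3 := by gcongr
      _ = 8^3*N0^3*B2^3 := by ring
      _ ≤ 8^3*N0^3*(8^3*(B1^2*B4)) := by gcongr
      _ = _ := by ring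
  have k3 : B3^4 ≤ 8^6*(N0*B4^3) := by
    refine le_of_mul_le_mul_right ?_ (pow_pos q3 2)
    calc B3^4*B3^2 = (B3^2)^3 := by ring
      _ ≤ (8*(B2*B4))^3 := by gcongr
      _ = 8^3*B2^3*B4^3 := by ring
      _ ≤ 8^3*(8^3*(N0*B3^2))*B4^3 := by gcongr
      _ = _ := by ring
  have k4 : B4 ≤ (2 + 16*8^6)*(N0+N4) := by
    by_cases hc : B3 ≤ B4/2
    · nlinarith
    · push Not at hc
      have : B4 ≤ 16*8^6*N0 := by
        refine le_of_mul_le_mul_right ?_ (pow_pos q4 3)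
        calc B4*B4^3 = 16*(B4/2)^4 := by ring
          _ ≤ 16*B3^4 := by gcongr
          _ ≤ 16*(8^6*(N0*B4^3)) := by gcongr
          _ = _ := by ring
      nlinarith
  calc N1^4 ≤ B1^4 := by gcongr
    _ ≤ 8^6*(N0^3*B4) := k1
    _ ≤ 8^6*(N0^3*((2 + 16*8^6)*(N0+N4))) := by gcongr
    _ = _ := by ring

lemma alg2 (N0 N1 N4 K : ℝ) (hK : 0 ≤ K) (h0 : 0 ≤ N0) (h1 : 0 ≤ N1) (h4 : 0 ≤ N4)
  (h : N1^4 ≤ K * (N0^3 * (N0+N4))) :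
  N1 ≤ (2*K+1) ^ ((1:ℝ)/4) * N0 ^ ((3:ℝ)/4) * (N0^2+N4^2)^((1:ℝ)/8) := by
  have hs : N0 + N4 ≤ 2 * (N0^2+N4^2)^((1:ℝ)/2) := by
    rw [← Real.sqrt_eq_rpow]
    have a : N0 ≤ √(N0^2+N4^2) := Real.le_sqrt_of_sq_le (by nlinarith)
    have b : N4 ≤ √(N0^2+N4^2) := Real.le_sqrt_of_sq_le (by nlinarith)
    linarith
  refine le_of_pow_le_pow_left₀ (n := 4) (by norm_num) (by positivity) ?_
  have e1 : ((2*K+1) ^ ((1:ℝ)/4))^4 = 2*K+1 := by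
    rw [← Real.rpow_natCast, ← Real.rpow_mul (by positivity)]; norm_num
  have e2 : (N0 ^ ((3:ℝ)/4))^4 = N0^3 := by
    rw [← Real.rpow_natCast, ← Real.rpow_mul h0, ← Real.rpow_natCast]; norm_num
  have e3 : ((N0^2+N4^2)^((1:ℝ)/8))^4 = (N0^2+N4^2)^((1:ℝ)/2) := by
    rw [← Real.rpow_natCast, ← Real.rpow_mul (by positivity)]; norm_num
  rw [mul_pow, mul_pow, e1, e2, e3]
  have : 0 ≤ N0^3 * (N0^2+N4^2)^((1:ℝ)/2) := by positivity
  calc N1^4 ≤ K * (N0^3 * (N0+N4)) := h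
    _ ≤ K * (N0^3 * (2 * (N0^2+N4^2)^((1:ℝ)/2))) := by gcongr
    _ ≤ _ := by linarith

/-- A smooth extension to the whole line of `t / (1 + t)`. -/
noncomputable def psiExt (t : ℝ) : ℝ := t / (1 + t * Real.smoothTransition (1 + t))

lemma psiExt_den_pos (t : ℝ) : 0 < 1 + t * Real.smoothTransition (1 + t) := by
  have h1 := Real.smoothTransition.le_one (1 + t)
  have h0 := Real.smoothTransition.nonneg (1 + t)
  rcases le_or_gt 0 t with h | h
  · positivity
  · rcases le_or_gt t (-1) with h' | h'
    · rw [Real.smoothTransition.zero_of_nonpos (by linarith)]; norm_num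
    · nlinarith

lemma psiExt_contDiff : ContDiff ℝ (⊤ : ℕ∞) psiExt := by
  unfold psiExt
  refine ContDiff.div contDiff_id ?_ (fun t => (psiExt_den_pos t).ne')
  exact contDiff_const.add (contDiff_id.mul
    (Real.smoothTransition.contDiff.comp (contDiff_const.add contDiff_id)))

lemma psiExt_eq {t : ℝ} (ht : 0 ≤ t) : psiExt t = t / (1 + t) := by
  unfold psiExt
  rw [Real.smoothTransition.one_of_one_le (by linarith), mul_one]

lemma psiExt_deriv {t : ℝ} (ht : 0 < t) : |deriv psiExt t| ≤ 1 := by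
  have h : psiExt =ᶠ[nhds t] fun s => s / (1 + s) := by
    filter_upwards [lt_mem_nhds ht] with s hs using psiExt_eq hs.le
  have h2 : HasDerivAt (fun s : ℝ => s / (1 + s)) ((1 * (1 + t) - t * 1) / (1 + t) ^ 2) t :=
    (hasDerivAt_id t).div ((hasDerivAt_id t).const_add 1) (by simp; linarith)
  rw [h.deriv_eq, h2.deriv]
  have : (1 * (1 + t) - t * 1) / (1 + t) ^ 2 = 1 / (1 + t) ^ 2 := by ring
  rw [this, abs_of_nonneg (by positivity), div_le_one (by positivity)]
  nlinarith

/-- Globally smooth version of `Z3`. -/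
noncomputable def Wext (f : (Fin 3 → ℝ) → ℝ) : (Fin 3 → ℝ) → ℝ :=
  fun x => psiExt (x 2) * pd3 f x

/-- The open upper half-space. -/
def HS : Set (Fin 3 → ℝ) := {x | 0 < x 2}

lemma HS_open : IsOpen HS := isOpen_lt continuous_const (continuous_apply 2)

lemma pd3_contDiff {f : (Fin 3 → ℝ) → ℝ} (hf : ContDiff ℝ (⊤ : ℕ∞) f) :
    ContDiff ℝ (⊤ : ℕ∞) (pd3 f) := by
  unfold pd3
  exact (hf.fderiv_right (m := (⊤ : ℕ∞)) (by simp)).clm_apply contDiff_const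

lemma psi2_contDiff : ContDiff ℝ (⊤ : ℕ∞) (fun x : Fin 3 → ℝ => psiExt (x 2)) :=
  psiExt_contDiff.comp (contDiff_apply ℝ ℝ 2)

lemma Wext_contDiff {f : (Fin 3 → ℝ) → ℝ} (hf : ContDiff ℝ (⊤ : ℕ∞) f) :
    ContDiff ℝ (⊤ : ℕ∞) (Wext f) := psi2_contDiff.mul (pd3_contDiff hf)

lemma pd3_supp {f : (Fin 3 → ℝ) → ℝ} (hf : HasCompactSupport f) :
    HasCompactSupport (pd3 f) := hf.fderiv_apply ℝ (Pi.single 2 1)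

lemma Wext_supp {f : (Fin 3 → ℝ) → ℝ} (hf : HasCompactSupport f) :
    HasCompactSupport (Wext f) := (pd3_supp hf).mul_left

lemma Z3_eq {f g : (Fin 3 → ℝ) → ℝ} (h : Set.EqOn f g HS) : Set.EqOn (Z3 f) (Wext g) HS := by
  intro x hx
  have : f =ᶠ[nhds x] g := h.eventuallyEq_of_mem (HS_open.mem_nhds hx)
  unfold Z3 Wext pd3
  rw [this.fderiv_eq, psiExt_eq (le_of_lt hx)]

lemma L2H_congr {f g : (Fin 3 → ℝ) → ℝ} (h : Set.EqOn f g HS) : L2H f = L2H g := by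
  unfold L2H
  congr 1
  apply eLpNorm_congr_ae
  exact (ae_restrict_iff' HS_open.measurableSet).2 (Filter.Eventually.of_forall h)

lemma memLp_of {f : (Fin 3 → ℝ) → ℝ} (hf : Continuous f) (hc : HasCompactSupport f) :
    MemLp f 2 (volume.restrict HS) := (hf.memLp_of_hasCompactSupport hc).restrict _

lemma L2H_eq {f : (Fin 3 → ℝ) → ℝ} (hf : Continuous f) (hc : HasCompactSupport f) :
    L2H f = (∫ x in HS, ‖f x‖ ^ (2:ℝ)) ^ ((1:ℝ)/2) := by
  unfold L2H
  change (eLpNorm f 2 (volume.restrict HS)).toReal = _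
  rw [(memLp_of hf hc).eLpNorm_eq_integral_rpow_norm (by norm_num) (by norm_num),
    ENNReal.toReal_ofReal (by positivity)]
  norm_num

lemma L2H_sq {f : (Fin 3 → ℝ) → ℝ} (hf : Continuous f) (hc : HasCompactSupport f) :
    L2H f ^ 2 = ∫ x in HS, f x * f x := by
  rw [L2H_eq hf hc, ← Real.sqrt_eq_rpow, Real.sq_sqrt (by positivity)]
  congr 1
  ext x
  rw [Real.rpow_two, Real.norm_eq_abs, sq_abs, sq]

lemma CS {f g : (Fin 3 → ℝ) → ℝ} (hf : Continuous f) (hc : HasCompactSupport f)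
    (hg : Continuous g) (hd : HasCompactSupport g) :
    ∫ x in HS, ‖f x‖ * ‖g x‖ ≤ L2H f * L2H g := by
  rw [L2H_eq hf hc, L2H_eq hg hd]
  refine integral_mul_norm_le_Lp_mul_Lq Real.HolderConjugate.two_two ?_ ?_
  · simpa using memLp_of hf hc
  · simpa using memLp_of hg hd

lemma int_pd3 {G : (Fin 3 → ℝ) → ℝ} (hG : ContDiff ℝ (⊤ : ℕ∞) G) (hc : HasCompactSupport G)
    (h0 : ∀ x : Fin 3 → ℝ, x 2 = 0 → G x = 0) : ∫ x in HS, pd3 G x = 0 := by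
  obtain ⟨R, hR0, hR⟩ : ∃ R > 0, ∀ x, R ≤ ‖x‖ → G x = 0 := by
    exact hc.exists_pos_le_norm
  have hGd : ∀ x, R < ‖x‖ → pd3 G x = 0 := by
    intro x hx
    have : G =ᶠ[nhds x] fun _ => 0 := by
      filter_upwards [(isOpen_lt continuous_const continuous_norm).mem_nhds hx] with y hy
      exact hR y (le_of_lt hy)
    unfold pd3
    rw [this.fderiv_eq]; simp
  set a : Fin 3 → ℝ := fun i => if i = 2 then 0 else -R with ha
  set b : Fin 3 → ℝ := fun i => R with hb
  have hab : a ≤ b := by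
    intro i; simp only [ha, hb]; split_ifs <;> linarith
  have hcont : Continuous (pd3 G) := (pd3_contDiff hG).continuous
  have hdiff : Differentiable ℝ G := hG.differentiable (by simp)
  have hsum : ∀ x, ∑ i : Fin 3, (if i = 2 then fderiv ℝ G x else 0) (Pi.single i 1) = pd3 G x := by
    intro x
    rw [Finset.sum_eq_single 2]
    · simp [pd3]
    · intro i _ hi; simp [hi]
    · simp
  have key := integral_divergence_of_hasFDerivAt_off_countable' a b hab
    (fun i => if i = 2 then G else fun _ => 0)
    (fun i x => if i = 2 then fderiv ℝ G x else 0) ∅ Set.countable_empty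
    (by
      intro i; split_ifs
      · exact hG.continuous.continuousOn
      · exact continuousOn_const)
    (by
      intro x _ i; split_ifs
      · exact (hdiff x).hasFDerivAt
      · exact hasFDerivAt_const _ _)
    (by
      simp only [hsum]
      exact hcont.continuousOn.integrableOn_compact isCompact_Icc)
  simp only [hsum] at key
  have hz : ∫ x in Set.Icc a b, pd3 G x = 0 := by
    rw [key]
    apply Finset.sum_eq_zero
    intro i _
    by_cases hi : i = 2
    · subst hi
      have e1 : ∀ x : Fin 2 → ℝ, G (Fin.insertNth 2 (b 2) x) = 0 := by
        intro x
        apply hR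
        have := norm_le_pi_norm (Fin.insertNth 2 (b 2) x : Fin 3 → ℝ) 2
        rw [Fin.insertNth_apply_same] at this
        exact (le_abs_self _).trans this
      have e2 : ∀ x : Fin 2 → ℝ, G (Fin.insertNth 2 (a 2) x) = 0 := by
        intro x
        apply h0
        rw [Fin.insertNth_apply_same]; simp [ha]
      simp [e1, e2]
    · simp [hi]
  set H' : Set (Fin 3 → ℝ) := {x | 0 ≤ x 2} with hH'
  have hae : HS =ᵐ[volume] H' := by
    have hn : ∀ᵐ x : Fin 3 → ℝ, x 2 ≠ 0 := by
      exact Measure.ae_eval_ne (μ := fun _ : Fin 3 => (volume : Measure ℝ)) 2 0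
    filter_upwards [hn] with x hx
    apply propext
    change 0 < x 2 ↔ 0 ≤ x 2
    exact ⟨le_of_lt, fun h => lt_of_le_of_ne h hx.symm⟩
  rw [setIntegral_congr_set hae, ← hz]
  apply setIntegral_eq_of_subset_of_forall_sdiff_eq_zero
  · exact (isClosed_le continuous_const (continuous_apply 2)).measurableSet
  · intro x hx
    have := hx.1 2
    simp only [ha, if_true] at this
    exact this
  · rintro x ⟨hx, hx'⟩
    apply hGd
    by_contra hcon
    push Not at hcon
    apply hx'
    have hb' : ∀ i, |x i| ≤ R := fun i => (norm_le_pi_norm x i).trans hcon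
    constructor
    · intro i
      simp only [ha]; split_ifs with hi
      · subst hi; exact hx
      · exact (abs_le.1 (hb' i)).1
    · intro i; exact (abs_le.1 (hb' i)).2

lemma pd3_mul {f g : (Fin 3 → ℝ) → ℝ} (hf : Differentiable ℝ f) (hg : Differentiable ℝ g)
    (x : Fin 3 → ℝ) : pd3 (fun y => f y * g y) x = f x * pd3 g x + g x * pd3 f x := by
  unfold pd3
  have h : HasFDerivAt (fun y => f y * g y) _ x := (hf x).hasFDerivAt.mul (hg x).hasFDerivAt
  rw [h.fderiv]
  simp

lemma pd3_psi (x : Fin 3 → ℝ) : pd3 (fun y => psiExt (y 2)) x = deriv psiExt (x 2) := by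
  unfold pd3
  have h1 : HasDerivAt psiExt (deriv psiExt (x 2)) (x 2) :=
    (psiExt_contDiff.differentiable (by simp) _).hasDerivAt
  have h2 : HasFDerivAt (fun y : Fin 3 → ℝ => y 2)
    (ContinuousLinearMap.proj (R := ℝ) (φ := fun _ : Fin 3 => ℝ) 2) x :=
    (ContinuousLinearMap.proj (R := ℝ) (φ := fun _ : Fin 3 => ℝ) 2).hasFDerivAt
  have h3 := h1.comp_hasFDerivAt x h2
  have h4 : HasFDerivAt (fun y : Fin 3 → ℝ => psiExt (y 2)) _ x := h3
  rw [h4.fderiv]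
  simp

lemma interp {g : (Fin 3 → ℝ) → ℝ} (hg : ContDiff ℝ (⊤ : ℕ∞) g) (hc : HasCompactSupport g) :
    L2H (Wext g) ^ 2 ≤ L2H g * L2H (Wext (Wext g)) + L2H g * L2H (Wext g) := by
  have w1 := Wext_contDiff hg
  have c1 := Wext_supp hc
  have w2 := Wext_contDiff w1
  have c2 := Wext_supp c1
  have hI := int_pd3 (G := fun x => psiExt (x 2) * (g x * Wext g x))
    (psi2_contDiff.mul (hg.mul w1)) (hc.mul_right.mul_left) (by
      intro x hx; simp [hx, psiExt])
  have hpd : ∀ x, pd3 (fun x => psiExt (x 2) * (g x * Wext g x)) x =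
      Wext g x * Wext g x +
        (g x * Wext (Wext g) x + deriv psiExt (x 2) * (g x * Wext g x)) := by
    intro x
    rw [pd3_mul (psi2_contDiff.differentiable (by simp))
      ((hg.mul w1).differentiable (by simp)), pd3_psi,
      pd3_mul (hg.differentiable (by simp)) (w1.differentiable (by simp))]
    simp only [Wext]; ring
  have dcont : Continuous (fun x : Fin 3 → ℝ => deriv psiExt (x 2)) :=
    (psiExt_contDiff.continuous_deriv (by simp)).comp (continuous_apply 2)
  have i1 : Integrable (fun x => Wext g x * Wext g x) (volume.restrict HS) :=
    ((w1.continuous.mul w1.continuous).integrable_of_hasCompactSupport c1.mul_right).restrict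
  have i2 : Integrable (fun x => g x * Wext (Wext g) x) (volume.restrict HS) :=
    ((hg.continuous.mul w2.continuous).integrable_of_hasCompactSupport hc.mul_right).restrict
  have i4 : Integrable (fun x => g x * Wext g x) (volume.restrict HS) :=
    ((hg.continuous.mul w1.continuous).integrable_of_hasCompactSupport hc.mul_right).restrict
  have i3 : Integrable (fun x => deriv psiExt (x 2) * (g x * Wext g x)) (volume.restrict HS) :=
    ((dcont.mul (hg.continuous.mul w1.continuous)).integrable_of_hasCompactSupport
      hc.mul_right.mul_left).restrict
  simp only [hpd] at hI
  have i23 : Integrable (fun x => g x * Wext (Wext g) x + deriv psiExt (x 2) * (g x * Wext g x))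
      (volume.restrict HS) := i2.add i3
  rw [integral_add i1 i23, integral_add i2 i3] at hI
  have b2 : -∫ x in HS, g x * Wext (Wext g) x ≤ L2H g * L2H (Wext (Wext g)) := by
    refine le_trans ?_ (CS hg.continuous hc w2.continuous c2)
    refine (neg_le_abs _).trans ?_
    rw [← Real.norm_eq_abs]
    refine (norm_integral_le_integral_norm _).trans_eq ?_
    simp only [norm_mul]
  have b3 : -∫ x in HS, deriv psiExt (x 2) * (g x * Wext g x) ≤ L2H g * L2H (Wext g) := by
    refine le_trans ?_ (CS hg.continuous hc w1.continuous c1)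
    refine (neg_le_abs _).trans ?_
    rw [← Real.norm_eq_abs]
    refine (norm_integral_le_integral_norm _).trans ?_
    simp only [← norm_mul]
    refine setIntegral_mono_on i3.norm i4.norm HS_open.measurableSet ?_
    intro x hx
    rw [norm_mul]
    exact mul_le_of_le_one_left (norm_nonneg _) (psiExt_deriv hx)
  rw [L2H_sq w1.continuous c1]
  linarith

/-- Interpolation inequality: `‖Z₃ f‖ ≲ ‖f‖^{3/4} (‖f‖² + ‖Z₃⁴ f‖²)^{1/8}`. -/
theorem stmt4 :
    ∃ C > (0 : ℝ), ∀ f : (Fin 3 → ℝ) → ℝ,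
      ContDiff ℝ (⊤ : ℕ∞) f → HasCompactSupport f →
      L2H (Z3 f) ≤ C * L2H f ^ ((3 : ℝ)/4) *
        (L2H f ^ 2 + L2H (Z3^[4] f) ^ 2) ^ ((1 : ℝ)/8) := by
  refine ⟨(2 * (8^6 * (2 + 16*8^6)) + 1) ^ ((1:ℝ)/4), by positivity, fun f hf hc => ?_⟩
  have z1 : Set.EqOn (Z3 f) (Wext f) HS := Z3_eq (fun _ _ => rfl)
  have z4 : Set.EqOn (Z3^[4] f) (Wext (Wext (Wext (Wext f)))) HS :=
    Z3_eq (Z3_eq (Z3_eq z1))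
  rw [L2H_congr z1, L2H_congr z4]
  have w1 := Wext_contDiff hf
  have c1 := Wext_supp hc
  have w2 := Wext_contDiff w1
  have c2 := Wext_supp c1
  have nn : ∀ g, 0 ≤ L2H g := fun g => ENNReal.toReal_nonneg
  exact alg2 _ _ _ _ (by positivity) (nn _) (nn _) (nn _)
    (alg _ _ _ _ _ (nn _) (nn _) (nn _) (nn _) (nn _) (interp hf hc) (interp w1 c1) (interp w2 c2))
end

section
/- For every s with 1/2 < s < 1 there exists a constant C > 0 such that for every smooth compactly supported function f : ℝ³ → ℝ, ( ∫_{ℝ²} ( sup_{x₃ > 0} |f(x_h, x₃)| )^{2/s} dx_h )^{s/2} ≤ C · ( ‖f‖_{L²}‖∂₂f‖_{L²} + ‖∂₁f‖_{L²}‖∂₁∂₂f‖_{L²} )^{(1-s)/2} · ‖f‖_{L²}^{(2s-1)/2} · ‖∂₃f‖_{L²}^{1/2}. -/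
open MeasureTheory

/-- Partial derivative in the `i`-th coordinate direction. -/
noncomputable def pd (i : Fin 3) (f : (Fin 3 → ℝ) → ℝ) : (Fin 3 → ℝ) → ℝ :=
  fun x => fderiv ℝ f x (Pi.single i 1)

section Helpers
open MeasureTheory Set
open scoped ENNReal

lemma oneD (h : ℝ → ℝ) (hh : ContDiff ℝ 1 h) (hc : HasCompactSupport h) (t : ℝ) :
    ‖h t‖ₑ ^ 2 ≤ 2 * ∫⁻ u in Ioi t, ‖h u‖ₑ * ‖deriv h u‖ₑ := by
  have h2 : ContDiff ℝ 1 (fun u => h u * h u) := hh.mul hh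
  have hc2 : HasCompactSupport (fun u => h u * h u) := hc.mul_right
  have e := hc2.integral_Ioi_deriv_eq h2 t
  have e2 : ‖h t‖ₑ ^ 2 = ‖∫ u in Ioi t, deriv (fun u => h u * h u) u‖ₑ := by
    rw [e, enorm_neg, enorm_mul, sq]
  rw [e2]
  refine (enorm_integral_le_lintegral_enorm _).trans ?_
  rw [← lintegral_const_mul' _ _ (by simp)]
  refine lintegral_mono fun u => ?_
  have hd := (hh.differentiable (by simp)) u
  have : deriv (fun u => h u * h u) u = 2 * (h u * deriv h u) := by
    rw [(hd.hasDerivAt.fun_mul hd.hasDerivAt).deriv]; ring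
  simp only [this, enorm_mul]
  rw [show ‖(2:ℝ)‖ₑ = 2 by simp [Real.enorm_eq_ofReal]]

lemma CS_s5 {α : Type*} [MeasurableSpace α] (μ : Measure α) (f g : α → ℝ≥0∞)
    (hf : AEMeasurable f μ) (hg : AEMeasurable g μ) :
    ∫⁻ a, f a * g a ∂μ ≤ (∫⁻ a, f a ^ 2 ∂μ) ^ (1/2 : ℝ) * (∫⁻ a, g a ^ 2 ∂μ) ^ (1/2 : ℝ) := by
  have := ENNReal.lintegral_mul_le_Lp_mul_Lq μ Real.HolderConjugate.two_two hf hg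
  simpa using this

noncomputable abbrev ν : Measure ℝ := volume.restrict (Ioi 0)

lemma snoc_eq (q : Fin 2 → ℝ) (z : ℝ) : (Fin.snoc q z : Fin 3 → ℝ) = ![q 0, q 1, z] := by
  ext i; fin_cases i <;> simp [Fin.snoc] 

lemma lint2 (G : (Fin 2 → ℝ) → ℝ≥0∞) :
    ∫⁻ q, G q = ∫⁻ p : ℝ × ℝ, G ![p.1, p.2] := by
  rw [← ((volume_preserving_finTwoArrow ℝ).symm _).lintegral_comp_emb (MeasurableEquiv.measurableEmbedding _)]
  rfl

lemma lint3 (G : (Fin 3 → ℝ) → ℝ≥0∞) (hG : Measurable G) :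
    ∫⁻ x in {x : Fin 3 → ℝ | 0 < x 2}, G x
      = ∫⁻ p : ℝ × (ℝ × ℝ), G ![p.1, p.2.1, p.2.2] ∂(volume.prod (volume.prod ν)) := by
  have h0 : MeasurableSet {x : Fin 3 → ℝ | 0 < x 2} := measurableSet_lt measurable_const (measurable_pi_apply _)
  have e : (volume.prod (volume.prod ν) : Measure (ℝ × (ℝ × ℝ))) =
      volume.restrict {p : ℝ × (ℝ × ℝ) | 0 < p.2.2} := by
    rw [show {p : ℝ × (ℝ × ℝ) | 0 < p.2.2} = univ ×ˢ (univ ×ˢ Ioi 0) by ext; simp]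
    rw [Measure.volume_eq_prod, ← Measure.prod_restrict, Measure.volume_eq_prod, ← Measure.prod_restrict]
    simp
  have h1 : MeasurableSet {p : ℝ × (ℝ × ℝ) | 0 < p.2.2} :=
    measurableSet_lt measurable_const (by fun_prop)
  rw [e, ← lintegral_indicator h0, ← lintegral_indicator h1]
  rw [← ((volume_preserving_piFinSuccAbove (fun _ : Fin 3 => ℝ) 0).symm _).lintegral_comp_emb (MeasurableEquiv.measurableEmbedding _)]
  have hm : Measurable ({p : ℝ × (ℝ × ℝ) | 0 < p.2.2}.indicator fun p => G ![p.1, p.2.1, p.2.2]) := by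
    refine Measurable.indicator (hG.comp (Continuous.measurable ?_)) h1
    fun_prop
  have := ((MeasurePreserving.id (volume : Measure ℝ)).prod (volume_preserving_finTwoArrow ℝ)).lintegral_comp hm
  rw [← Measure.volume_eq_prod, ← Measure.volume_eq_prod] at this
  rw [← this]
  refine lintegral_congr fun p => ?_
  have e3 : (MeasurableEquiv.piFinSuccAbove (fun _ : Fin 3 => ℝ) 0).symm p = ![p.1, p.2 0, p.2 1] := by
    ext i; fin_cases i <;> simp [MeasurableEquiv.piFinSuccAbove] <;> rfl
  rw [e3]
  rfl

lemma pd_smooth (i : Fin 3) {f : (Fin 3 → ℝ) → ℝ} (hf : ContDiff ℝ (⊤ : ℕ∞) f) :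
    ContDiff ℝ (⊤ : ℕ∞) (pd i f) := by
  unfold pd
  exact (hf.fderiv_right (m := ((⊤ : ℕ∞) : WithTop ℕ∞)) (by simp)).clm_apply contDiff_const

lemma pd_supp (i : Fin 3) {f : (Fin 3 → ℝ) → ℝ} (hf : HasCompactSupport f) :
    HasCompactSupport (pd i f) := hf.fderiv_apply (𝕜 := ℝ) _

lemma slice (i : Fin 3) {f : (Fin 3 → ℝ) → ℝ} (hf : ContDiff ℝ (⊤ : ℕ∞) f)
    (hc : HasCompactSupport f) (p : Fin 3 → ℝ) (t : ℝ) :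
    ‖f (Function.update p i t)‖ₑ ^ 2 ≤
      2 * ∫⁻ u in Ioi t, ‖f (Function.update p i u)‖ₑ * ‖pd i f (Function.update p i u)‖ₑ := by
  have hf1 : ContDiff ℝ 1 f := hf.of_le (by exact_mod_cast le_top)
  have h := oneD (fun u => f (Function.update p i u)) (hf1.comp (contDiff_update 1 p i))
    (hc.comp_isClosedEmbedding (isClosedEmbedding_update p i)) t
  refine h.trans (le_of_eq ?_)
  congr 2 with u
  congr 2
  have := ((hf1.differentiable (by simp)) (Function.update p i u)).hasFDerivAt.comp_hasDerivAt u
    (hasDerivAt_update p i u)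
  exact this.deriv

lemma slice' (i : Fin 3) {f : (Fin 3 → ℝ) → ℝ} (hf : ContDiff ℝ (⊤ : ℕ∞) f)
    (hc : HasCompactSupport f) (p : Fin 3 → ℝ) (t : ℝ) :
    ‖f (Function.update p i t)‖ₑ ^ 2 ≤
      2 * ∫⁻ u, ‖f (Function.update p i u)‖ₑ * ‖pd i f (Function.update p i u)‖ₑ :=
  (slice i hf hc p t).trans (by gcongr; exact Measure.restrict_le_self)

lemma up0 (a x y z : ℝ) : Function.update ![a, y, z] 0 x = ![x, y, z] := by
  ext i; fin_cases i <;> simp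
lemma up1 (a x y z : ℝ) : Function.update ![x, a, z] 1 y = ![x, y, z] := by
  ext i; fin_cases i <;> simp
lemma up2 (a x y z : ℝ) : Function.update ![x, y, a] 2 z = ![x, y, z] := by
  ext i; fin_cases i <;> simp

noncomputable def EH (f : (Fin 3 → ℝ) → ℝ) : ℝ≥0∞ :=
  eLpNorm f 2 (volume.restrict {x : Fin 3 → ℝ | 0 < x 2})

lemma EH_sq {f : (Fin 3 → ℝ) → ℝ} (hf : Continuous f) :
    ∫⁻ p : ℝ × (ℝ × ℝ), ‖f ![p.1, p.2.1, p.2.2]‖ₑ ^ 2 ∂(volume.prod (volume.prod ν)) = EH f ^ 2 := by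
  unfold EH
  rw [← lint3 (fun x => ‖f x‖ₑ ^ 2) (by fun_prop),
    eLpNorm_eq_lintegral_rpow_enorm_toReal (by simp) (by simp), ← ENNReal.rpow_two, ← ENNReal.rpow_mul]
  simp

lemma EH_top {f : (Fin 3 → ℝ) → ℝ} (hf : Continuous f) (hc : HasCompactSupport f) : EH f ≠ ⊤ :=
  ((hf.memLp_of_hasCompactSupport (μ := volume) hc).restrict _).eLpNorm_ne_top

lemma sq_half (a : ℝ≥0∞) : (a ^ 2) ^ (1/2 : ℝ) = a := by
  rw [← ENNReal.rpow_two, ← ENNReal.rpow_mul]; simp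

lemma half_sq (a : ℝ≥0∞) : (a ^ (1/2 : ℝ)) ^ 2 = a := by
  rw [← ENNReal.rpow_two, ← ENNReal.rpow_mul]; simp

lemma planeBound {f : (Fin 3 → ℝ) → ℝ} (hf : ContDiff ℝ (⊤ : ℕ∞) f)
    (hc : HasCompactSupport f) (x : ℝ) :
    ∫⁻ w : ℝ × ℝ, ‖f ![x, w.1, w.2]‖ₑ ^ 2 ∂(volume.prod ν) ≤ 2 * (EH f * EH (pd 0 f)) := by
  have c0 := hf.continuous
  have c1 := (pd_smooth 0 hf).continuous
  calc _ ≤ ∫⁻ w : ℝ × ℝ, 2 * (∫⁻ u : ℝ, ‖f ![u, w.1, w.2]‖ₑ * ‖pd 0 f ![u, w.1, w.2]‖ₑ) ∂(volume.prod ν) := by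
        refine lintegral_mono fun w => ?_
        simpa only [up0] using slice' 0 hf hc ![0, w.1, w.2] x
    _ = 2 * ∫⁻ u, ∫⁻ w : ℝ × ℝ, ‖f ![u, w.1, w.2]‖ₑ * ‖pd 0 f ![u, w.1, w.2]‖ₑ ∂(volume.prod ν) := by
        rw [lintegral_const_mul' _ _ (by simp), lintegral_lintegral_swap]
        refine Continuous.aemeasurable ?_ |>.enorm.mul (Continuous.aemeasurable ?_).enorm
        · fun_prop
        · fun_prop
    _ = 2 * ∫⁻ p : ℝ × (ℝ × ℝ), ‖f ![p.1, p.2.1, p.2.2]‖ₑ * ‖pd 0 f ![p.1, p.2.1, p.2.2]‖ₑ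
          ∂(volume.prod (volume.prod ν)) := by
        rw [lintegral_prod]
        refine Continuous.aemeasurable ?_ |>.enorm.mul (Continuous.aemeasurable ?_).enorm
        · fun_prop
        · fun_prop
    _ ≤ _ := by
        gcongr
        refine (CS_s5 _ _ _ ?_ ?_).trans (le_of_eq ?_)
        · refine (Continuous.aemeasurable ?_).enorm
          fun_prop
        · refine (Continuous.aemeasurable ?_).enorm
          fun_prop
        · rw [EH_sq c0, EH_sq c1, sq_half, sq_half]

noncomputable def MM (f : (Fin 3 → ℝ) → ℝ) : ℝ≥0∞ :=
  EH f * EH (pd 1 f) + EH (pd 0 f) * EH (pd 0 (pd 1 f))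

lemma supA {f : (Fin 3 → ℝ) → ℝ} (hf : ContDiff ℝ (⊤ : ℕ∞) f)
    (hc : HasCompactSupport f) (x y : ℝ) :
    ∫⁻ z, ‖f ![x, y, z]‖ₑ ^ 2 ∂ν ≤ 4 * MM f := by
  have c0 := hf.continuous
  have c1 := (pd_smooth 1 hf).continuous
  calc _ ≤ ∫⁻ z, 2 * (∫⁻ u : ℝ, ‖f ![x, u, z]‖ₑ * ‖pd 1 f ![x, u, z]‖ₑ) ∂ν := by
        refine lintegral_mono fun z => ?_
        simpa only [up1] using slice' 1 hf hc ![x, 0, z] y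
    _ = 2 * ∫⁻ w : ℝ × ℝ, ‖f ![x, w.1, w.2]‖ₑ * ‖pd 1 f ![x, w.1, w.2]‖ₑ ∂(volume.prod ν) := by
        rw [lintegral_const_mul' _ _ (by simp), lintegral_prod_symm]
        refine Continuous.aemeasurable ?_ |>.enorm.mul (Continuous.aemeasurable ?_).enorm
        · fun_prop
        · fun_prop
    _ ≤ 2 * ((2 * (EH f * EH (pd 0 f))) ^ (1/2 : ℝ) *
          (2 * (EH (pd 1 f) * EH (pd 0 (pd 1 f)))) ^ (1/2 : ℝ)) := by
        gcongr
        refine (CS_s5 _ _ _ ?_ ?_).trans ?_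
        · refine (Continuous.aemeasurable ?_).enorm
          fun_prop
        · refine (Continuous.aemeasurable ?_).enorm
          fun_prop
        · gcongr
          · exact planeBound hf hc x
          · exact planeBound (pd_smooth 1 hf) (pd_supp 1 hc) x
    _ ≤ 2 * ((2 * MM f) ^ 2) ^ (1/2 : ℝ) := by
        rw [← ENNReal.mul_rpow_of_nonneg _ _ (by norm_num)]
        gcongr
        calc _ = (2 * (EH f * EH (pd 1 f))) * (2 * (EH (pd 0 f) * EH (pd 0 (pd 1 f)))) := by ring
          _ ≤ (2 * MM f) * (2 * MM f) := by
            unfold MM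
            gcongr
            · exact le_self_add
            · exact le_add_self
          _ = _ := by ring
    _ = _ := by rw [sq_half]; ring

lemma supBound {f : (Fin 3 → ℝ) → ℝ} (hf : ContDiff ℝ (⊤ : ℕ∞) f)
    (hc : HasCompactSupport f) (x y : ℝ) :
    ‖⨆ x3 : {t : ℝ // 0 < t}, |f ![x, y, x3]|‖ₑ ^ 2 ≤
      2 * ((∫⁻ z, ‖f ![x, y, z]‖ₑ ^ 2 ∂ν) ^ (1/2 : ℝ) *
        (∫⁻ z, ‖pd 2 f ![x, y, z]‖ₑ ^ 2 ∂ν) ^ (1/2 : ℝ)) := by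
  have c0 := hf.continuous
  have c1 := (pd_smooth 2 hf).continuous
  set X := 2 * ((∫⁻ z, ‖f ![x, y, z]‖ₑ ^ 2 ∂ν) ^ (1/2 : ℝ) *
        (∫⁻ z, ‖pd 2 f ![x, y, z]‖ₑ ^ 2 ∂ν) ^ (1/2 : ℝ)) with hX
  have key : ∀ t : ℝ, 0 < t → ‖f ![x, y, t]‖ₑ ^ 2 ≤ X := by
    intro t ht
    have := slice 2 hf hc ![x, y, 0] t
    simp only [up2] at this
    refine this.trans ?_
    rw [hX]
    gcongr
    refine le_trans ?_ (CS_s5 ν _ _ ?_ ?_)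
    · exact lintegral_mono' (Measure.restrict_mono (Ioi_subset_Ioi ht.le) le_rfl) le_rfl
    · refine (Continuous.aemeasurable ?_).enorm
      fun_prop
    · refine (Continuous.aemeasurable ?_).enorm
      fun_prop
  by_cases hT : X = ⊤
  · rw [hT]; exact le_top
  have hY : X ^ (1/2 : ℝ) ≠ ⊤ := ENNReal.rpow_ne_top_of_nonneg (by norm_num) hT
  have : ⨆ x3 : {t : ℝ // 0 < t}, |f ![x, y, x3]| ≤ (X ^ (1/2 : ℝ)).toReal := by
    haveI : Nonempty {t : ℝ // 0 < t} := ⟨⟨1, one_pos⟩⟩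
    refine ciSup_le fun t => ?_
    have h := ENNReal.rpow_le_rpow (key t t.2) (z := 1/2) (by norm_num)
    rw [sq_half] at h
    have := ENNReal.toReal_mono hY h
    simpa using this
  have h2 : ‖⨆ x3 : {t : ℝ // 0 < t}, |f ![x, y, x3]|‖ₑ ≤ X ^ (1/2 : ℝ) := by
    rw [Real.enorm_of_nonneg (Real.iSup_nonneg fun _ => abs_nonneg _)]
    exact ENNReal.ofReal_le_of_le_toReal this
  calc _ ≤ (X ^ (1/2 : ℝ)) ^ 2 := by gcongr
    _ = X := half_sq X

lemma mainE {f : (Fin 3 → ℝ) → ℝ} (hf : ContDiff ℝ (⊤ : ℕ∞) f)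
    (hc : HasCompactSupport f) (s : ℝ) (hs : 1/2 < s) (hs1 : s < 1) :
    (∫⁻ p : ℝ × ℝ, ‖⨆ x3 : {t : ℝ // 0 < t}, |f ![p.1, p.2, x3]|‖ₑ ^ (2/s)) ^ (s/2) ≤
      8 * MM f ^ ((1-s)/2) * EH f ^ ((2*s-1)/2) * EH (pd 2 f) ^ (1/2 : ℝ) := by
  have hs0 : 0 < s := by linarith
  have c0 := hf.continuous
  have c1 := (pd_smooth 2 hf).continuous
  set A : ℝ × ℝ → ℝ≥0∞ := fun p => ∫⁻ z, ‖f ![p.1, p.2, z]‖ₑ ^ 2 ∂ν with hA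
  set B : ℝ × ℝ → ℝ≥0∞ := fun p => ∫⁻ z, ‖pd 2 f ![p.1, p.2, z]‖ₑ ^ 2 ∂ν with hB
  have hm : ∀ g : (Fin 3 → ℝ) → ℝ, Continuous g →
      Measurable (fun q : (ℝ × ℝ) × ℝ => ‖g ![q.1.1, q.1.2, q.2]‖ₑ ^ 2) := by
    intro g hg
    refine Measurable.pow_const (Measurable.enorm (Continuous.measurable ?_)) _
    fun_prop
  have hm' : ∀ g : (Fin 3 → ℝ) → ℝ, Continuous g →
      Measurable (fun p : ℝ × (ℝ × ℝ) => ‖g ![p.1, p.2.1, p.2.2]‖ₑ ^ 2) := by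
    intro g hg
    refine Measurable.pow_const (Measurable.enorm (Continuous.measurable ?_)) _
    fun_prop
  have mA : Measurable A := (hm f c0).lintegral_prod_right'
  have mB : Measurable B := (hm _ c1).lintegral_prod_right'
  have iI : ∀ g : (Fin 3 → ℝ) → ℝ, Continuous g →
      ∫⁻ p : ℝ × ℝ, ∫⁻ z, ‖g ![p.1, p.2, z]‖ₑ ^ 2 ∂ν = EH g ^ 2 := by
    intro g hg
    rw [← EH_sq hg, lintegral_prod _ (hm' g hg).aemeasurable, Measure.volume_eq_prod,
      lintegral_prod _ ((hm g hg).lintegral_prod_right').aemeasurable]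
    refine lintegral_congr fun x => ?_
    rw [lintegral_prod]
    exact ((hm' g hg).comp (measurable_prodMk_left (x := x))).aemeasurable
  have iA : ∫⁻ p, A p = EH f ^ 2 := iI f c0
  have iB : ∫⁻ p, B p = EH (pd 2 f) ^ 2 := iI _ c1
  have e1 : 0 ≤ (1-s)/s := div_nonneg (by linarith) hs0.le
  have e2 : 0 ≤ 1 - 1/(2*s) := by
    rw [sub_nonneg, div_le_one (by linarith)]; linarith
  have step : ∫⁻ p : ℝ × ℝ, ‖⨆ x3 : {t : ℝ // 0 < t}, |f ![p.1, p.2, x3]|‖ₑ ^ (2/s) ≤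
      2 ^ (1/s) * (4 * MM f) ^ ((1-s)/s) *
        ((EH f ^ 2) ^ (1 - 1/(2*s)) * (EH (pd 2 f) ^ 2) ^ (1/(2*s))) := by
    calc _ ≤ ∫⁻ p : ℝ × ℝ, 2 ^ (1/s) * (4 * MM f) ^ ((1-s)/s) *
          (A p ^ (1 - 1/(2*s)) * B p ^ (1/(2*s))) := by
          refine lintegral_mono fun p => ?_
          have hb := ENNReal.rpow_le_rpow (supBound hf hc p.1 p.2) (z := 1/s) (by positivity)
          rw [← ENNReal.rpow_two, ← ENNReal.rpow_mul, mul_one_div] at hb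
          refine hb.trans ?_
          change (2 * (A p ^ (1/2:ℝ) * B p ^ (1/2:ℝ))) ^ (1/s) ≤ _
          rw [ENNReal.mul_rpow_of_nonneg _ _ (by positivity),
            ENNReal.mul_rpow_of_nonneg _ _ (by positivity), ← ENNReal.rpow_mul, ← ENNReal.rpow_mul,
            show 1/2 * (1/s) = 1/(2*s) by field_simp]
          have hAp : A p ^ (1/(2*s)) ≤ (4 * MM f) ^ ((1-s)/s) * A p ^ (1 - 1/(2*s)) := by
            rw [show 1/(2*s) = (1-s)/s + (1 - 1/(2*s)) by field_simp; ring,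
              ENNReal.rpow_add_of_nonneg _ _ e1 e2]
            rw [show (1 - ((1-s)/s + (1 - 1/(2*s)))) = 1 - 1/(2*s) by field_simp; ring]
            gcongr
            exact supA hf hc p.1 p.2
          calc _ ≤ 2 ^ (1/s) * (((4 * MM f) ^ ((1-s)/s) * A p ^ (1 - 1/(2*s))) * B p ^ (1/(2*s))) := by
                gcongr
            _ = _ := by ring
      _ = 2 ^ (1/s) * (4 * MM f) ^ ((1-s)/s) *
          ∫⁻ p, (A p ^ (1 - 1/(2*s)) * B p ^ (1/(2*s))) := by
          rw [lintegral_const_mul]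
          exact (mA.pow_const _).mul (mB.pow_const _)
      _ ≤ _ := by
          gcongr
          rw [← iA, ← iB]
          exact ENNReal.lintegral_mul_norm_pow_le mA.aemeasurable mB.aemeasurable e2 (by positivity)
            (by ring)
  have hs2 : 0 ≤ s/2 := by positivity
  refine (ENNReal.rpow_le_rpow step hs2).trans ?_
  rw [ENNReal.mul_rpow_of_nonneg _ _ hs2, ENNReal.mul_rpow_of_nonneg _ _ hs2,
    ENNReal.mul_rpow_of_nonneg _ _ hs2]
  simp only [← ENNReal.rpow_two, ← ENNReal.rpow_mul]
  rw [show 1/s * (s/2) = 1/2 by field_simp, show (1-s)/s * (s/2) = (1-s)/2 by field_simp,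
    show 2 * (1 - 1/(2*s)) * (s/2) = (2*s-1)/2 by field_simp,
    show 2 * (1/(2*s)) * (s/2) = 1/2 by field_simp,
    ENNReal.mul_rpow_of_nonneg _ _ (by linarith)]
  have k1 : (2:ℝ≥0∞) ^ (1/2:ℝ) ≤ 2 := by
    conv_rhs => rw [← ENNReal.rpow_one 2]
    exact ENNReal.rpow_le_rpow_of_exponent_le (by norm_num) (by norm_num)
  have k2 : (4:ℝ≥0∞) ^ ((1-s)/2:ℝ) ≤ 4 := by
    conv_rhs => rw [← ENNReal.rpow_one 4]
    exact ENNReal.rpow_le_rpow_of_exponent_le (by norm_num) (by linarith)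
  calc _ ≤ 2 * (4 * MM f ^ ((1-s)/2)) * (EH f ^ ((2*s-1)/2) * EH (pd 2 f) ^ (1/2 : ℝ)) := by gcongr
    _ = _ := by ring


end Helpers

/-- The `L^{2/s}(ℝ²)` norm (to the power 1) of `x_h ↦ sup_{x₃>0} |f(x_h,x₃)|`,
bounded by an anisotropic product of L² norms. -/
theorem stmt5 :
    ∀ s : ℝ, 1/2 < s → s < 1 →
    ∃ C > (0 : ℝ), ∀ f : (Fin 3 → ℝ) → ℝ,
      ContDiff ℝ (⊤ : ℕ∞) f → HasCompactSupport f →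
      (∫ xh : Fin 2 → ℝ,
          (⨆ x3 : {t : ℝ // 0 < t}, |f (Fin.snoc xh (x3 : ℝ))|) ^ (2/s)) ^ (s/2) ≤
        C * (L2H f * L2H (pd 1 f) + L2H (pd 0 f) * L2H (pd 0 (pd 1 f))) ^ ((1 - s)/2) *
          L2H f ^ ((2*s - 1)/2) * L2H (pd 2 f) ^ ((1 : ℝ)/2) := by
  intro s hs hs1
  refine ⟨8, by norm_num, fun f hf hc => ?_⟩
  have hs0 : 0 < s := by linarith
  have t0 := EH_top hf.continuous hc
  have t1 := EH_top (pd_smooth 1 hf).continuous (pd_supp 1 hc)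
  have t2 := EH_top (pd_smooth 2 hf).continuous (pd_supp 2 hc)
  have t3 := EH_top (pd_smooth 0 hf).continuous (pd_supp 0 hc)
  have t4 := EH_top (pd_smooth 0 (pd_smooth 1 hf)).continuous (pd_supp 0 (pd_supp 1 hc))
  have hM : MM f ≠ ⊤ := by
    unfold MM
    exact ENNReal.add_ne_top.2 ⟨ENNReal.mul_ne_top t0 t1, ENNReal.mul_ne_top t3 t4⟩
  have hMr : (MM f).toReal = L2H f * L2H (pd 1 f) + L2H (pd 0 f) * L2H (pd 0 (pd 1 f)) := by
    unfold MM
    rw [ENNReal.toReal_add (ENNReal.mul_ne_top t0 t1) (ENNReal.mul_ne_top t3 t4),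
      ENNReal.toReal_mul, ENNReal.toReal_mul]
    rfl
  have main := mainE hf hc s hs hs1
  have hfin : 8 * MM f ^ ((1-s)/2) * EH f ^ ((2*s-1)/2) * EH (pd 2 f) ^ (1/2 : ℝ) ≠ ⊤ := by
    refine ENNReal.mul_ne_top (ENNReal.mul_ne_top (ENNReal.mul_ne_top (by simp) ?_) ?_) ?_
    · exact ENNReal.rpow_ne_top_of_nonneg (by linarith) hM
    · exact ENNReal.rpow_ne_top_of_nonneg (by linarith) t0
    · exact ENNReal.rpow_ne_top_of_nonneg (by norm_num) t2
  have hnn : 0 ≤ ∫ xh : Fin 2 → ℝ,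
      (⨆ x3 : {t : ℝ // 0 < t}, |f (Fin.snoc xh (x3 : ℝ))|) ^ (2/s) :=
    integral_nonneg fun _ => Real.rpow_nonneg (Real.iSup_nonneg fun _ => abs_nonneg _) _
  have hle : ‖∫ xh : Fin 2 → ℝ,
      (⨆ x3 : {t : ℝ // 0 < t}, |f (Fin.snoc xh (x3 : ℝ))|) ^ (2/s)‖ₑ ≤
      ∫⁻ p : ℝ × ℝ, ‖⨆ x3 : {t : ℝ // 0 < t}, |f ![p.1, p.2, x3]|‖ₑ ^ (2/s) := by
    refine (enorm_integral_le_lintegral_enorm _).trans (le_of_eq ?_)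
    rw [lint2]
    refine lintegral_congr fun p => ?_
    have e : ∀ t : ℝ, (Fin.snoc ![p.1, p.2] t : Fin 3 → ℝ) = ![p.1, p.2, t] := fun t => by
      rw [snoc_eq]; rfl
    have hn : 0 ≤ ⨆ x3 : {t : ℝ // 0 < t}, |f ![p.1, p.2, x3]| :=
      Real.iSup_nonneg fun _ => abs_nonneg _
    simp only [e]
    rw [Real.enorm_of_nonneg (Real.rpow_nonneg hn _), Real.enorm_of_nonneg hn,
      ENNReal.ofReal_rpow_of_nonneg hn (by positivity)]
  have h := (ENNReal.rpow_le_rpow hle (z := s/2) (by positivity)).trans main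
  have h' := ENNReal.toReal_mono hfin h
  rw [← ENNReal.toReal_rpow, toReal_enorm, Real.norm_of_nonneg hnn, ENNReal.toReal_mul,
    ENNReal.toReal_mul, ENNReal.toReal_mul, ← ENNReal.toReal_rpow, ← ENNReal.toReal_rpow,
    ← ENNReal.toReal_rpow, hMr] at h'
  exact h'
end

section
/- For every s with 0 < s < 1 there exists a constant C > 0 such that for every Schwartz function f : ℝ² → ℂ, ‖∇f‖_{L²} ≤ C · ‖Λ^{-s}f‖_{L²}^{1/(s+2)} · ‖∇²f‖_{L²}^{(s+1)/(s+2)}. -/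
open MeasureTheory SchwartzMap

open scoped FourierTransform

/-- The negative-order homogeneous Sobolev norm
`‖Λ^{-s} f‖_{L²} = (∫ ‖ξ‖^{-2s} ‖𝓕f(ξ)‖² dξ)^{1/2}`. -/
noncomputable def negSobNorm (s : ℝ)
    (f : SchwartzMap (EuclideanSpace ℝ (Fin 2)) ℂ) : ℝ :=
  (∫ ξ : EuclideanSpace ℝ (Fin 2), ‖ξ‖ ^ (-(2*s)) * ‖𝓕 (⇑f) ξ‖ ^ 2) ^ ((1 : ℝ)/2)

/-- The L² norm of the `n`-th total derivative of `f`. -/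
noncomputable def derivL2Norm (n : ℕ)
    (f : SchwartzMap (EuclideanSpace ℝ (Fin 2)) ℂ) : ℝ :=
  (eLpNorm (fun x => iteratedFDeriv ℝ n (⇑f) x) 2 volume).toReal

open LineDeriv
local notation "E2" => EuclideanSpace ℝ (Fin 2)

lemma aux_int_iter (n : ℕ) (f : SchwartzMap E2 ℂ) :
    Integrable (fun x => ‖iteratedFDeriv ℝ n (⇑f) x‖ ^ 2) := by
  have h := f.integrable_pow_mul_iteratedFDeriv (μ := volume) 0 n
  simp only [pow_zero, one_mul] at h
  have hc : Continuous (fun x => iteratedFDeriv ℝ n (⇑f) x) :=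
    (f.smooth n).continuous_iteratedFDeriv le_rfl
  refine (h.const_mul (SchwartzMap.seminorm ℝ 0 n f)).mono' (by fun_prop) (.of_forall fun x => ?_)
  rw [Real.norm_of_nonneg (by positivity), sq]
  gcongr
  exact norm_iteratedFDeriv_le_seminorm ℝ f n x

lemma aux_deriv_sq (n : ℕ) (f : SchwartzMap E2 ℂ) :
    derivL2Norm n f ^ 2 = ∫ x, ‖iteratedFDeriv ℝ n (⇑f) x‖ ^ 2 := by
  have hc : Continuous (fun x => iteratedFDeriv ℝ n (⇑f) x) :=
    (f.smooth n).continuous_iteratedFDeriv le_rfl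
  have hm : MemLp (fun x => iteratedFDeriv ℝ n (⇑f) x) 2 volume :=
    (memLp_two_iff_integrable_sq_norm hc.aestronglyMeasurable).2 (aux_int_iter n f)
  have h0 : 0 ≤ ∫ x, ‖iteratedFDeriv ℝ n (⇑f) x‖ ^ 2 := integral_nonneg fun x => by positivity
  unfold derivL2Norm
  rw [hm.eLpNorm_eq_integral_rpow_norm (by simp) (by simp),
    ENNReal.toReal_ofReal (by positivity)]
  simp only [ENNReal.toReal_ofNat, Real.rpow_two]
  rw [← Real.rpow_natCast, ← Real.rpow_mul h0]
  norm_num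

lemma aux_int_sq (g : SchwartzMap E2 ℂ) : Integrable (fun x => ‖g x‖ ^ 2) := by
  simpa using aux_int_iter 0 g

lemma aux_fourier_d (f : SchwartzMap E2 ℂ) (m ξ : E2) :
    ‖𝓕 (∂_{m} f) ξ‖ = 2 * Real.pi * |inner ℝ ξ m| * ‖𝓕 f ξ‖ := by
  have : (inner ℝ · m : E2 → ℝ).HasTemperateGrowth := ((innerSL ℝ).flip m).hasTemperateGrowth
  rw [fourier_lineDerivOp_eq]
  simp [smulLeftCLM_apply_apply this, abs_of_pos Real.pi_pos]
  ring

local notation "e" => EuclideanSpace.basisFun (Fin 2) ℝ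

lemma aux_d1 (f : SchwartzMap E2 ℂ) (x : E2) :
    ‖iteratedFDeriv ℝ 1 (⇑f) x‖ ^ 2 ≤ ∑ i, ‖∂_{e i} f x‖ ^ 2 := by
  rw [norm_iteratedFDeriv_one]
  have : ‖fderiv ℝ f x‖ ≤ √(∑ i, ‖∂_{e i} f x‖ ^ 2) := by
    refine ContinuousLinearMap.opNorm_le_bound _ (by positivity) fun v => ?_
    have hv : v = ∑ i, v i • e i := by
      simpa using ((e).sum_repr v).symm
    conv_lhs => rw [hv]
    rw [map_sum, EuclideanSpace.norm_eq, mul_comm]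
    simp only [map_smul, ← lineDerivOp_apply_eq_fderiv]
    refine (norm_sum_le _ _).trans ?_
    simp only [norm_smul]
    exact Real.sum_mul_le_sqrt_mul_sqrt _ _ _
  calc _ ≤ (√(∑ i, ‖∂_{e i} f x‖ ^ 2)) ^ 2 := by gcongr
    _ = _ := Real.sq_sqrt (by positivity)

lemma aux_d2 (f : SchwartzMap E2 ℂ) (i : Fin 2) (x : E2) :
    ‖∂_{e i} (∂_{e i} f) x‖ ^ 2 ≤ ‖iteratedFDeriv ℝ 2 (⇑f) x‖ ^ 2 := by
  have h : ∂_{e i} (∂_{e i} f) x = iteratedFDeriv ℝ 2 (⇑f) x ![e i, e i] := by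
    rw [← iteratedLineDerivOp_eq_iteratedFDeriv]
    simp [iteratedLineDerivOp_succ_left]
  gcongr
  rw [h]
  refine (ContinuousMultilinearMap.le_opNorm _ _).trans ?_
  simp

lemma aux_sq_norm (ξ : E2) : ∑ i, |inner ℝ ξ (e i)| ^ 2 = ‖ξ‖ ^ 2 := by
  rw [EuclideanSpace.norm_sq_eq]
  simp [EuclideanSpace.inner_single_right]

lemma aux_D1 (f : SchwartzMap E2 ℂ) :
    Integrable (fun ξ => ‖ξ‖ ^ 2 * ‖𝓕 f ξ‖ ^ 2) ∧
    derivL2Norm 1 f ^ 2 ≤ (2 * Real.pi) ^ 2 * ∫ ξ, ‖ξ‖ ^ 2 * ‖𝓕 f ξ‖ ^ 2 := by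
  have key : ∀ ξ : E2, ∑ i, ‖𝓕 (∂_{e i} f) ξ‖ ^ 2 =
      (2 * Real.pi) ^ 2 * (‖ξ‖ ^ 2 * ‖𝓕 f ξ‖ ^ 2) := by
    intro ξ
    simp only [aux_fourier_d, ← aux_sq_norm ξ, Fin.sum_univ_two]
    ring
  have hI : Integrable (fun ξ => (2 * Real.pi) ^ 2 * (‖ξ‖ ^ 2 * ‖𝓕 f ξ‖ ^ 2)) := by
    simp only [← key]
    exact integrable_finsetSum _ fun i _ => aux_int_sq _
  refine ⟨(integrable_const_mul_iff (by simp [Real.pi_ne_zero]) _).1 hI, ?_⟩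
  rw [aux_deriv_sq, ← integral_const_mul]
  simp only [← key]
  rw [integral_finsetSum _ fun i _ => aux_int_sq _]
  simp only [integral_norm_sq_fourier]
  rw [← integral_finsetSum _ fun i _ => aux_int_sq _]
  exact integral_mono (aux_int_iter 1 f) (integrable_finsetSum _ fun i _ => aux_int_sq _)
    (aux_d1 f)

lemma aux_D2 (f : SchwartzMap E2 ℂ) :
    Integrable (fun ξ => ‖ξ‖ ^ 4 * ‖𝓕 f ξ‖ ^ 2) ∧
    (∫ ξ, ‖ξ‖ ^ 4 * ‖𝓕 f ξ‖ ^ 2) ≤ 4 * derivL2Norm 2 f ^ 2 := by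
  have key : ∀ ξ : E2, ‖ξ‖ ^ 4 * ‖𝓕 f ξ‖ ^ 2 ≤
      2 * ∑ i, ‖𝓕 (∂_{e i} (∂_{e i} f)) ξ‖ ^ 2 := by
    intro ξ
    simp only [aux_fourier_d]
    have h1 : ‖ξ‖ ^ 4 = (∑ i, |inner ℝ ξ (e i)| ^ 2) ^ 2 := by rw [aux_sq_norm]; ring
    have hp : 1 ≤ (2 * Real.pi) ^ 4 := one_le_pow₀ (by linarith [Real.pi_gt_three])
    rw [h1]
    simp only [Fin.sum_univ_two]
    generalize |inner ℝ ξ (e 0)| = a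
    generalize |inner ℝ ξ (e 1)| = b
    calc _ ≤ (2 * (a ^ 4 + b ^ 4)) * ‖𝓕 f ξ‖ ^ 2 := by
          gcongr; nlinarith [sq_nonneg (a ^ 2 - b ^ 2)]
      _ ≤ (2 * Real.pi) ^ 4 * ((2 * (a ^ 4 + b ^ 4)) * ‖𝓕 f ξ‖ ^ 2) :=
          le_mul_of_one_le_left (by positivity) hp
      _ = _ := by ring
  have hS : Integrable (fun ξ => 2 * ∑ i, ‖𝓕 (∂_{e i} (∂_{e i} f)) ξ‖ ^ 2) :=
    (integrable_finsetSum _ fun i _ => aux_int_sq _).const_mul _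
  have hI : Integrable (fun ξ => ‖ξ‖ ^ 4 * ‖𝓕 f ξ‖ ^ 2) := by
    refine hS.mono' ?_ (.of_forall fun ξ => ?_)
    · have := (𝓕 f).continuous
      fun_prop
    · rw [Real.norm_of_nonneg (by positivity)]; exact key ξ
  refine ⟨hI, (integral_mono hI hS key).trans ?_⟩
  rw [integral_const_mul, integral_finsetSum _ fun i _ => aux_int_sq _]
  simp only [integral_norm_sq_fourier, Fin.sum_univ_two]
  have h (i) := integral_mono (aux_int_sq (∂_{e i} (∂_{e i} f))) (aux_int_iter 2 f) (aux_d2 f i)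
  rw [← aux_deriv_sq] at h
  linarith [h 0, h 1]

lemma aux_neg (s : ℝ) (hs : 0 < s) (hs1 : s < 1) (f : SchwartzMap E2 ℂ) :
    Integrable (fun ξ => ‖ξ‖ ^ (-(2*s)) * ‖𝓕 f ξ‖ ^ 2) := by
  have hb : IntegrableOn (fun ξ : E2 => ‖ξ‖ ^ (-(2*s))) (Metric.ball 0 1) := by
    rw [integrableOn_fun_norm_addHaar volume (f := fun r => r ^ (-(2*s)))]
    simp only [finrank_euclideanSpace, Fintype.card_fin, smul_eq_mul]
    have : IntegrableOn (fun r : ℝ => r ^ (1 - 2 * s)) (Set.Ioo 0 1) :=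
      (intervalIntegral.integrableOn_Ioo_rpow_iff one_pos).2 (by linarith)
    refine this.congr_fun (fun r hr => ?_) measurableSet_Ioo
    simp only
    rw [sub_eq_add_neg, Real.rpow_add hr.1]
    simp
  have hi := (hb.integrable_indicator measurableSet_ball).const_mul
    ((SchwartzMap.seminorm ℝ 0 0 (𝓕 f)) ^ 2)
  refine (hi.add (aux_int_sq (𝓕 f))).mono' ?_ (.of_forall fun ξ => ?_)
  · have := (𝓕 f).continuous
    have h2 : Measurable (fun ξ : E2 => ‖ξ‖ ^ (-(2*s))) := by fun_prop
    exact (h2.mul (by fun_prop)).aestronglyMeasurable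
  · rw [Real.norm_of_nonneg (by positivity)]
    simp only [Pi.add_apply]
    by_cases h : ξ ∈ Metric.ball (0 : E2) 1
    · rw [Set.indicator_of_mem h, mul_comm]
      have := norm_le_seminorm ℝ (𝓕 f) ξ
      have h3 : ‖𝓕 f ξ‖ ^ 2 * ‖ξ‖ ^ (-(2*s)) ≤
        SchwartzMap.seminorm ℝ 0 0 (𝓕 f) ^ 2 * ‖ξ‖ ^ (-(2*s)) := by gcongr
      linarith [sq_nonneg ‖𝓕 f ξ‖]
    · rw [Set.indicator_of_notMem h]
      simp only [mul_zero, zero_add]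
      have h1 : 1 ≤ ‖ξ‖ := by simpa using h
      exact mul_le_of_le_one_left (by positivity)
        (Real.rpow_le_one_of_one_le_of_nonpos h1 (by linarith))

lemma aux_holder (s : ℝ) (hs : 0 < s) (hs1 : s < 1) (f : SchwartzMap E2 ℂ) :
    ∫ ξ, ‖ξ‖ ^ 2 * ‖𝓕 f ξ‖ ^ 2 ≤
      (∫ ξ, ‖ξ‖ ^ (-(2*s)) * ‖𝓕 f ξ‖ ^ 2) ^ (1/(s+2)) *
      (∫ ξ, ‖ξ‖ ^ 4 * ‖𝓕 f ξ‖ ^ 2) ^ ((s+1)/(s+2)) := by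
  have hA := aux_neg s hs hs1 f
  have hB := (aux_D2 f).1
  have hp : 0 ≤ 1/(s+2) := by positivity
  have hq : 0 ≤ (s+1)/(s+2) := by positivity
  have hpq : 1/(s+2) + (s+1)/(s+2) = 1 := by field_simp; ring
  have hA0 : ∀ ξ : E2, 0 ≤ ‖ξ‖ ^ (-(2*s)) * ‖𝓕 f ξ‖ ^ 2 := fun ξ => by positivity
  have hB0 : ∀ ξ : E2, 0 ≤ ‖ξ‖ ^ 4 * ‖𝓕 f ξ‖ ^ 2 := fun ξ => by positivity
  have H := ENNReal.lintegral_mul_norm_pow_le (μ := volume)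
    hA.aemeasurable.ennreal_ofReal hB.aemeasurable.ennreal_ofReal hp hq hpq
  rw [← ofReal_integral_eq_lintegral_ofReal hA (.of_forall hA0),
    ← ofReal_integral_eq_lintegral_ofReal hB (.of_forall hB0),
    ENNReal.ofReal_rpow_of_nonneg (integral_nonneg hA0) hp,
    ENNReal.ofReal_rpow_of_nonneg (integral_nonneg hB0) hq,
    ← ENNReal.ofReal_mul (Real.rpow_nonneg (integral_nonneg hA0) _)] at H
  have hA1 := Real.rpow_nonneg (integral_nonneg hA0 (μ := volume)) (1/(s+2))
  have hB1 := Real.rpow_nonneg (integral_nonneg hB0 (μ := volume)) ((s+1)/(s+2))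
  rw [← ENNReal.ofReal_le_ofReal_iff (mul_nonneg hA1 hB1),
    ofReal_integral_eq_lintegral_ofReal (aux_D1 f).1 (.of_forall fun ξ => by positivity)]
  refine le_trans (le_of_eq (lintegral_congr fun ξ => ?_)) H
  rw [ENNReal.ofReal_rpow_of_nonneg (hA0 ξ) hp, ENNReal.ofReal_rpow_of_nonneg (hB0 ξ) hq,
    ← ENNReal.ofReal_mul (Real.rpow_nonneg (hA0 ξ) _)]
  congr 1
  rcases eq_or_ne ξ 0 with rfl | h
  · have : (s+1)/(s+2) ≠ 0 := by positivity
    simp [Real.zero_rpow this]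
  have hx : 0 < ‖ξ‖ := norm_pos_iff.2 h
  rw [Real.mul_rpow (by positivity) (by positivity), Real.mul_rpow (by positivity) (by positivity),
    mul_mul_mul_comm, ← Real.rpow_add_of_nonneg (by positivity) hp hq, hpq, Real.rpow_one,
    ← Real.rpow_natCast ‖ξ‖ 4, ← Real.rpow_mul hx.le, ← Real.rpow_mul hx.le, ← Real.rpow_add hx,
    ← Real.rpow_natCast ‖ξ‖ 2]
  congr 2
  push_cast
  field_simp
  ring

/-- Interpolation: `‖∇f‖_{L²} ≲ ‖Λ^{-s}f‖_{L²}^{1/(s+2)} ‖∇²f‖_{L²}^{(s+1)/(s+2)}`. -/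
theorem stmt8 :
    ∀ s : ℝ, 0 < s → s < 1 →
    ∃ C > (0 : ℝ), ∀ f : SchwartzMap (EuclideanSpace ℝ (Fin 2)) ℂ,
      derivL2Norm 1 f ≤ C * negSobNorm s f ^ (1/(s+2)) *
        derivL2Norm 2 f ^ ((s+1)/(s+2)) := by
  intro s hs hs1
  refine ⟨2 * Real.pi * 2 ^ ((s+1)/(s+2)), by positivity, fun f => ?_⟩
  have hq : 0 ≤ (s+1)/(s+2) := by positivity
  have hA0 : 0 ≤ ∫ ξ : E2, ‖ξ‖ ^ (-(2*s)) * ‖𝓕 f ξ‖ ^ 2 :=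
    integral_nonneg fun ξ => by positivity
  have hB0 : 0 ≤ ∫ ξ : E2, ‖ξ‖ ^ 4 * ‖𝓕 f ξ‖ ^ 2 :=
    integral_nonneg fun ξ => by positivity
  have hN0 : 0 ≤ negSobNorm s f := Real.rpow_nonneg hA0 _
  have hD0 : 0 ≤ derivL2Norm 2 f := ENNReal.toReal_nonneg
  have hN : ∫ ξ : E2, ‖ξ‖ ^ (-(2*s)) * ‖𝓕 f ξ‖ ^ 2 = negSobNorm s f ^ 2 := by
    unfold negSobNorm
    simp only [← fourier_coe]
    rw [← Real.rpow_natCast _ 2, ← Real.rpow_mul hA0]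
    norm_num
  refine le_of_sq_le_sq ?_ (by positivity)
  calc derivL2Norm 1 f ^ 2 ≤ _ := (aux_D1 f).2
    _ ≤ (2 * Real.pi) ^ 2 * ((negSobNorm s f ^ 2) ^ (1/(s+2)) *
        ((2 * derivL2Norm 2 f) ^ 2) ^ ((s+1)/(s+2))) := by
      gcongr
      refine (aux_holder s hs hs1 f).trans ?_
      rw [hN]
      gcongr
      refine (aux_D2 f).2.trans (le_of_eq (by ring))
    _ = _ := by
      have h (x p : ℝ) (hx : 0 ≤ x) : (x ^ 2) ^ p = (x ^ p) ^ 2 := by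
        rw [← Real.rpow_natCast, ← Real.rpow_natCast, ← Real.rpow_mul hx, ← Real.rpow_mul hx,
          mul_comm]
      rw [h _ _ hN0, h _ _ (by positivity), Real.mul_rpow (by positivity) hD0]
      ring
end

section
/- For every s with 0 < s < 1 there exists a constant C > 0 such that for every Schwartz function f : ℝ² → ℂ, ‖f‖_{L²} ≤ C · ‖Λ^{-s}f‖_{L²}^{2/(s+2)} · ‖∇²f‖_{L²}^{s/(s+2)}. -/
open MeasureTheory SchwartzMap

open scoped FourierTransform

/-- The Fourier plane. -/
abbrev Plane := EuclideanSpace ℝ (Fin 2)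

lemma holder_aux {α : Type*} [MeasurableSpace α] {μ : Measure α} {a b : α → ℝ}
    (ha : Integrable a μ) (hb : Integrable b μ) (ha0 : ∀ x, 0 ≤ a x) (hb0 : ∀ x, 0 ≤ b x)
    {p q : ℝ} (hp : 0 ≤ p) (hq : 0 ≤ q) (hpq : p + q = 1) :
    ∫ x, a x ^ p * b x ^ q ∂μ ≤ (∫ x, a x ∂μ) ^ p * (∫ x, b x ∂μ) ^ q := by
  have h := ENNReal.lintegral_mul_norm_pow_le (μ := μ) (f := fun x => ENNReal.ofReal (a x))
    (g := fun x => ENNReal.ofReal (b x)) ha.aemeasurable.ennreal_ofReal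
    hb.aemeasurable.ennreal_ofReal hp hq hpq
  rw [← ofReal_integral_eq_lintegral_ofReal ha (ae_of_all _ ha0),
    ← ofReal_integral_eq_lintegral_ofReal hb (ae_of_all _ hb0),
    ENNReal.ofReal_rpow_of_nonneg (integral_nonneg ha0) hp,
    ENNReal.ofReal_rpow_of_nonneg (integral_nonneg hb0) hq,
    ← ENNReal.ofReal_mul (Real.rpow_nonneg (integral_nonneg ha0) _)] at h
  rw [integral_eq_lintegral_of_nonneg_ae
    (ae_of_all _ fun x => mul_nonneg (Real.rpow_nonneg (ha0 x) _) (Real.rpow_nonneg (hb0 x) _))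
    ((ha.aemeasurable.pow_const p).mul (hb.aemeasurable.pow_const q)).aestronglyMeasurable]
  refine ENNReal.toReal_le_of_le_ofReal (mul_nonneg (Real.rpow_nonneg (integral_nonneg ha0) _)
    (Real.rpow_nonneg (integral_nonneg hb0) _)) (le_trans (le_of_eq ?_) h)
  refine lintegral_congr fun x => ?_
  rw [ENNReal.ofReal_mul (Real.rpow_nonneg (ha0 x) _), ENNReal.ofReal_rpow_of_nonneg (ha0 x) hp,
    ENNReal.ofReal_rpow_of_nonneg (hb0 x) hq]

lemma integrable_normSq (g : SchwartzMap Plane ℂ) : Integrable (fun x => ‖g x‖ ^ 2) :=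
  (memLp_two_iff_integrable_sq_norm g.continuous.aestronglyMeasurable).1 (g.memLp 2)

lemma integrable_weight (s : ℝ) (hs : 0 < s) (hs1 : s < 1) (g : SchwartzMap Plane ℂ) :
    Integrable (fun ξ => ‖ξ‖ ^ (-(2*s)) * ‖g ξ‖ ^ 2) := by
  have hm : AEStronglyMeasurable (fun ξ : Plane => ‖ξ‖ ^ (-(2*s)) * ‖g ξ‖ ^ 2) volume := by
    have := g.continuous.measurable
    exact Measurable.aestronglyMeasurable (by fun_prop)
  obtain ⟨C, hC⟩ : ∃ C, ∀ x, ‖g x‖ ≤ C :=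
    ⟨_, fun x => SchwartzMap.norm_le_seminorm ℝ g x⟩
  rw [← integrableOn_univ, ← Set.union_compl_self (Metric.ball (0:Plane) 1)]
  refine IntegrableOn.union ?_ ?_
  · refine integrableOn_ball_of_norm_le_rpow (C := C^2) (α := 2*s) (by simp) ?_ ?_ hm
    · simp; linarith
    · refine ae_of_all _ fun x => ?_
      rw [Real.norm_of_nonneg (by positivity), mul_comm]
      gcongr
      exact hC x
  · refine Integrable.mono' (integrable_normSq g).integrableOn hm.restrict ?_
    refine (ae_restrict_iff' Metric.isOpen_ball.measurableSet.compl).2 (ae_of_all _ fun x hx => ?_)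
    have hx1 : 1 ≤ ‖x‖ := by simpa using hx
    rw [Real.norm_of_nonneg (by positivity)]
    have : ‖x‖ ^ (-(2*s)) ≤ 1 := Real.rpow_le_one_of_one_le_of_nonpos hx1 (by linarith)
    nlinarith [sq_nonneg ‖g x‖]

open Laplacian in
lemma fourier_lap (f : SchwartzMap Plane ℂ) (ξ : Plane) :
    ‖𝓕 (Δ f) ξ‖ = (2 * Real.pi) ^ 2 * (‖ξ‖ ^ 2 * ‖𝓕 f ξ‖) := by
  have ht : (fun x : Plane => ‖x‖ ^ 2).HasTemperateGrowth := by fun_prop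
  have h : 𝓕 (Δ f) = -(2 * Real.pi) ^ 2 • smulLeftCLM ℂ (fun x : Plane => ‖x‖ ^ 2) (𝓕 f) := by
    rw [laplacian_eq_fourierMultiplierCLM, fourierMultiplierCLM_apply]
    simp
  rw [h]
  simp [smulLeftCLM_apply_apply ht, abs_of_pos Real.pi_pos]

lemma memLp_iter (f : SchwartzMap Plane ℂ) :
    MemLp (fun x => iteratedFDeriv ℝ 2 (⇑f) x) 2 volume := by
  have hc : Continuous (fun x => iteratedFDeriv ℝ 2 (⇑f) x) :=
    (f.smooth 2).continuous_iteratedFDeriv (by norm_num)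
  rw [memLp_two_iff_integrable_sq_norm hc.aestronglyMeasurable]
  have h1 := SchwartzMap.integrable_pow_mul_iteratedFDeriv volume f 0 2
  refine Integrable.mono' (h1.const_mul (SchwartzMap.seminorm ℝ 0 2 f))
    (hc.norm.pow 2).aestronglyMeasurable (ae_of_all _ fun x => ?_)
  rw [Real.norm_of_nonneg (by positivity), pow_zero, one_mul, sq]
  gcongr
  exact norm_iteratedFDeriv_le_seminorm ℝ f 2 x

open Laplacian in
lemma lap_le (f : SchwartzMap Plane ℂ) (x : Plane) :
    ‖Δ f x‖ ≤ 2 * ‖iteratedFDeriv ℝ 2 (⇑f) x‖ := by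
  rw [laplacian_apply, InnerProductSpace.laplacian_eq_iteratedFDeriv_orthonormalBasis _
    (EuclideanSpace.basisFun (Fin 2) ℝ)]
  beta_reduce
  rw [Fin.sum_univ_two, two_mul]
  refine (norm_add_le _ _).trans (add_le_add ?_ ?_) <;>
  · refine (ContinuousMultilinearMap.le_opNorm _ _).trans (le_of_eq ?_)
    simp [Fin.prod_univ_two]

lemma eLp_sq {F : Type*} [NormedAddCommGroup F] {g : Plane → F} (hg : MemLp g 2 volume) :
    (eLpNorm g 2 volume).toReal ^ 2 = ∫ x, ‖g x‖ ^ 2 := by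
  have h0 : (0:ℝ) ≤ ∫ x, ‖g x‖ ^ 2 := integral_nonneg fun x => by positivity
  rw [hg.eLpNorm_eq_integral_rpow_norm (by norm_num) (by norm_num)]
  simp only [ENNReal.toReal_ofNat, Real.rpow_two]
  rw [ENNReal.toReal_ofReal (by positivity), ← Real.rpow_natCast, ← Real.rpow_mul h0]
  norm_num

open Laplacian in
lemma high_le (f : SchwartzMap Plane ℂ) :
    ∫ ξ, ‖ξ‖ ^ 4 * ‖𝓕 f ξ‖ ^ 2 ≤ derivL2Norm 2 f ^ 2 := by
  have h1 : ∫ ξ, ‖𝓕 (Δ f) ξ‖ ^ 2 = (2 * Real.pi) ^ 4 * ∫ ξ, ‖ξ‖ ^ 4 * ‖𝓕 f ξ‖ ^ 2 := by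
    rw [← integral_const_mul]
    congr 1; ext ξ; rw [fourier_lap]; ring
  have h2 : ∫ x, ‖Δ f x‖ ^ 2 ≤ 4 * derivL2Norm 2 f ^ 2 := by
    rw [derivL2Norm, eLp_sq (memLp_iter f), ← integral_const_mul]
    refine integral_mono (integrable_normSq _)
      (((memLp_two_iff_integrable_sq_norm (memLp_iter f).1).1 (memLp_iter f)).const_mul _)
      fun x => ?_
    have := lap_le f x
    have h0 := norm_nonneg (Δ f x)
    dsimp only
    nlinarith
  rw [integral_norm_sq_fourier] at h1
  have h0 : (0:ℝ) ≤ ∫ ξ, ‖ξ‖ ^ 4 * ‖𝓕 f ξ‖ ^ 2 := integral_nonneg fun x => by positivity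
  have hpi : (4:ℝ) ≤ (2 * Real.pi) ^ 4 := by
    have := Real.pi_gt_three
    calc (4:ℝ) ≤ 6 ^ 4 := by norm_num
      _ ≤ _ := by gcongr; linarith
  nlinarith

open Laplacian in
lemma integrable_high (f : SchwartzMap Plane ℂ) :
    Integrable (fun ξ => ‖ξ‖ ^ 4 * ‖𝓕 f ξ‖ ^ 2) := by
  have h := (integrable_normSq (𝓕 (Δ f))).const_mul (((2 * Real.pi) ^ 4)⁻¹)
  refine h.congr (ae_of_all _ fun ξ => ?_)
  have := Real.pi_pos
  simp only [fourier_lap]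
  field_simp

lemma main_sq (s : ℝ) (hs : 0 < s) (hs1 : s < 1) (f : SchwartzMap Plane ℂ) :
    (eLpNorm (⇑f) 2 volume).toReal ^ 2 ≤
      (∫ ξ, ‖ξ‖ ^ (-(2*s)) * ‖𝓕 f ξ‖ ^ 2) ^ (2/(s+2)) *
        (∫ ξ, ‖ξ‖ ^ 4 * ‖𝓕 f ξ‖ ^ 2) ^ (s/(s+2)) := by
  rw [eLp_sq (f.memLp 2), ← integral_norm_sq_fourier]
  have hpq : 2/(s+2) + s/(s+2) = 1 := by field_simp; ring
  refine le_trans (le_of_eq (integral_congr_ae ?_))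
    (holder_aux (integrable_weight s hs hs1 (𝓕 f)) (integrable_high f)
    (fun x => by positivity) (fun x => by positivity) (by positivity) (by positivity) hpq)
  filter_upwards [Measure.ae_ne volume (0 : Plane)] with ξ hξ
  have hr : 0 < ‖ξ‖ := norm_pos_iff.2 hξ
  have hG : 0 ≤ ‖𝓕 f ξ‖ ^ 2 := by positivity
  rw [Real.mul_rpow (by positivity) hG, Real.mul_rpow (by positivity) hG,
    ← Real.rpow_natCast ‖ξ‖ 4, ← Real.rpow_mul hr.le, ← Real.rpow_mul hr.le,
    mul_mul_mul_comm, ← Real.rpow_add hr, ← Real.rpow_add_of_nonneg hG (by positivity)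
    (by positivity), hpq, Real.rpow_one]
  have : -(2 * s) * (2 / (s + 2)) + ((4:ℕ):ℝ) * (s / (s + 2)) = 0 := by
    push_cast; field_simp; ring
  rw [this, Real.rpow_zero, one_mul]

/-- Interpolation: `‖f‖_{L²} ≲ ‖Λ^{-s}f‖_{L²}^{2/(s+2)} ‖∇²f‖_{L²}^{s/(s+2)}`. -/
theorem stmt9 :
    ∀ s : ℝ, 0 < s → s < 1 →
    ∃ C > (0 : ℝ), ∀ f : SchwartzMap (EuclideanSpace ℝ (Fin 2)) ℂ,
      (eLpNorm (⇑f) 2 volume).toReal ≤ C * negSobNorm s f ^ (2/(s+2)) *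
        derivL2Norm 2 f ^ (s/(s+2)) := by
  intro s hs hs1
  refine ⟨1, one_pos, fun f => ?_⟩
  have hA : (0:ℝ) ≤ ∫ ξ : Plane, ‖ξ‖ ^ (-(2*s)) * ‖𝓕 (⇑f) ξ‖ ^ 2 :=
    integral_nonneg fun x => by positivity
  have hB : (0:ℝ) ≤ ∫ ξ : Plane, ‖ξ‖ ^ 4 * ‖𝓕 f ξ‖ ^ 2 :=
    integral_nonneg fun x => by positivity
  have hD : 0 ≤ derivL2Norm 2 f := ENNReal.toReal_nonneg
  have hN : 0 ≤ negSobNorm s f := Real.rpow_nonneg hA _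
  have hN2 : negSobNorm s f ^ 2 = ∫ ξ : Plane, ‖ξ‖ ^ (-(2*s)) * ‖𝓕 (⇑f) ξ‖ ^ 2 := by
    rw [negSobNorm, ← Real.rpow_natCast, ← Real.rpow_mul hA]
    norm_num
  rw [one_mul]
  refine (sq_le_sq₀ ENNReal.toReal_nonneg (by positivity)).1 ?_
  have h := main_sq s hs hs1 f
  rw [fourier_coe, ← hN2] at h
  refine h.trans ?_
  have h3 := Real.rpow_le_rpow hB (high_le f) (show 0 ≤ s/(s+2) by positivity)
  rw [fourier_coe] at h3
  refine (mul_le_mul_of_nonneg_left h3 (by positivity)).trans (le_of_eq ?_)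
  rw [mul_pow, ← Real.rpow_natCast (negSobNorm s f), ← Real.rpow_natCast (derivL2Norm 2 f),
    ← Real.rpow_natCast (negSobNorm s f ^ _), ← Real.rpow_natCast (derivL2Norm 2 f ^ _),
    ← Real.rpow_mul hN, ← Real.rpow_mul hN, ← Real.rpow_mul hD, ← Real.rpow_mul hD,
    mul_comm ((2:ℕ):ℝ), mul_comm ((2:ℕ):ℝ)]
end

section
/- For every s with 0 < s < 1 there exists a constant C > 0 such that for every Schwartz function f : ℝ² → ℂ, ‖f‖_{L²} ≤ C · ‖Λ^{-s}f‖_{L²}^{1/(1+s)} · ‖∇f‖_{L²}^{s/(1+s)}. -/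
open MeasureTheory SchwartzMap

open scoped FourierTransform

abbrev EE := EuclideanSpace ℝ (Fin 2)

lemma aux_sq_int {F : Type*} [NormedAddCommGroup F] [NormedSpace ℝ F] (g : SchwartzMap EE F) :
    Integrable (fun x => ‖g x‖ ^ 2) :=
  (memLp_two_iff_integrable_sq_norm g.continuous.aestronglyMeasurable).1 (g.memLp 2)

lemma aux_rad (s : ℝ) (h1 : s < 1) :
    Integrable (fun x : EE => (Set.Ioo (0:ℝ) 1).indicator (fun y => y ^ (-(2*s))) ‖x‖) := by
  rw [integrable_fun_norm_addHaar volume (f := (Set.Ioo (0:ℝ) 1).indicator (fun y => y ^ (-(2*s))))]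
  have h : IntegrableOn (fun y : ℝ => y ^ (1 - 2*s)) (Set.Ioo 0 1) :=
    (intervalIntegral.integrableOn_Ioo_rpow_iff one_pos).2 (by linarith)
  have h2 := (integrable_indicator_iff measurableSet_Ioo).2 h
  refine (h2.congr (ae_of_all _ fun y => ?_)).integrableOn
  by_cases hy : y ∈ Set.Ioo (0:ℝ) 1
  · simp only [Set.indicator_of_mem hy, finrank_euclideanSpace, Fintype.card_fin]
    rw [sub_eq_add_neg, Real.rpow_add hy.1]
    simp
  · simp [Set.indicator_of_notMem hy]

lemma aux_A (s : ℝ) (h0 : 0 < s) (h1 : s < 1) (g : SchwartzMap EE ℂ) :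
    Integrable (fun ξ : EE => ‖ξ‖ ^ (-(2*s)) * ‖g ξ‖ ^ 2) := by
  obtain ⟨M, hM⟩ := g.decay 0 0
  have hM' : ∀ x, ‖g x‖ ≤ M := by simpa using hM.2
  refine (((aux_rad s h1).const_mul (M^2)).add (aux_sq_int g)).mono' ?_ ?_
  · refine Measurable.aestronglyMeasurable ?_
    have := g.continuous.measurable
    fun_prop
  · have : ∀ᵐ x : EE, x ≠ 0 := by simp [ae_iff]
    filter_upwards [this] with x hx
    have hx' : 0 < ‖x‖ := norm_pos_iff.2 hx
    have hp : 0 < ‖x‖ ^ (-(2*s)) := Real.rpow_pos_of_pos hx' _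
    rw [Real.norm_of_nonneg (by positivity)]
    simp only [Pi.add_apply]
    by_cases hlt : ‖x‖ < 1
    · have hmem : ‖x‖ ∈ Set.Ioo (0:ℝ) 1 := ⟨hx', hlt⟩
      rw [Set.indicator_of_mem hmem]
      have : ‖g x‖ ^ 2 ≤ M ^ 2 := by gcongr; exact hM' x
      nlinarith [sq_nonneg ‖g x‖]
    · rw [Set.indicator_of_notMem (fun h => hlt h.2)]
      have : ‖x‖ ^ (-(2*s)) ≤ 1 :=
        Real.rpow_le_one_of_one_le_of_nonpos (not_lt.1 hlt) (by linarith)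
      nlinarith [sq_nonneg ‖g x‖]

lemma aux_hol (s : ℝ) (h0 : 0 < s) (h1 : s < 1) (g : SchwartzMap EE ℂ)
    (hB : Integrable (fun ξ : EE => ‖ξ‖ ^ 2 * ‖g ξ‖ ^ 2)) :
    ∫ ξ, ‖g ξ‖ ^ 2 ≤ (∫ ξ : EE, ‖ξ‖ ^ (-(2*s)) * ‖g ξ‖ ^ 2) ^ (1/(1+s)) *
      (∫ ξ : EE, ‖ξ‖ ^ 2 * ‖g ξ‖ ^ 2) ^ (s/(1+s)) := by
  have hA := aux_A s h0 h1 g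
  have nA : 0 ≤ᵐ[volume] (fun ξ : EE => ‖ξ‖ ^ (-(2*s)) * ‖g ξ‖ ^ 2) :=
    ae_of_all _ fun x => by positivity
  have nB : 0 ≤ᵐ[volume] (fun ξ : EE => ‖ξ‖ ^ 2 * ‖g ξ‖ ^ 2) :=
    ae_of_all _ fun x => by positivity
  have key := ENNReal.lintegral_mul_norm_pow_le (μ := volume)
    hA.aestronglyMeasurable.aemeasurable.ennreal_ofReal
    hB.aestronglyMeasurable.aemeasurable.ennreal_ofReal
    (p := 1/(1+s)) (q := s/(1+s)) (by positivity) (by positivity) (by field_simp)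
  rw [← ofReal_integral_eq_lintegral_ofReal hA nA, ← ofReal_integral_eq_lintegral_ofReal hB nB,
    ENNReal.ofReal_rpow_of_nonneg (integral_nonneg_of_ae nA) (by positivity),
    ENNReal.ofReal_rpow_of_nonneg (integral_nonneg_of_ae nB) (by positivity),
    ← ENNReal.ofReal_mul (Real.rpow_nonneg (integral_nonneg_of_ae nA) _)] at key
  have e : ∫⁻ a : EE, ENNReal.ofReal (‖a‖ ^ (-(2*s)) * ‖g a‖ ^ 2) ^ (1/(1+s)) *
      ENNReal.ofReal (‖a‖ ^ 2 * ‖g a‖ ^ 2) ^ (s/(1+s)) = ∫⁻ a, ENNReal.ofReal (‖g a‖ ^ 2) := by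
    refine lintegral_congr_ae ?_
    have : ∀ᵐ x : EE, x ≠ 0 := by simp [ae_iff]
    filter_upwards [this] with x hx
    have hx' : 0 < ‖x‖ := norm_pos_iff.2 hx
    rw [ENNReal.ofReal_rpow_of_nonneg (by positivity) (by positivity),
      ENNReal.ofReal_rpow_of_nonneg (by positivity) (by positivity),
      ← ENNReal.ofReal_mul (by positivity)]
    congr 1
    rw [Real.mul_rpow (by positivity) (by positivity), Real.mul_rpow (by positivity) (by positivity),
      ← Real.rpow_natCast ‖x‖ 2, ← Real.rpow_mul hx'.le, ← Real.rpow_mul hx'.le]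
    calc _ = (‖x‖ ^ (-(2*s) * (1/(1+s))) * ‖x‖ ^ (((2:ℕ):ℝ) * (s/(1+s)))) *
        ((‖g x‖^2) ^ (1/(1+s)) * (‖g x‖^2) ^ (s/(1+s))) := by ring
      _ = 1 * ‖g x‖^2 := by
        congr 1
        · rw [← Real.rpow_add hx']
          convert Real.rpow_zero _ using 2
          push_cast
          field_simp
          ring
        · rw [← Real.rpow_add_of_nonneg (by positivity) (by positivity) (by positivity)]
          convert Real.rpow_one _ using 2
          field_simp
      _ = _ := one_mul _
  rw [e, ← ofReal_integral_eq_lintegral_ofReal (aux_sq_int g) (ae_of_all _ fun x => by positivity)]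
    at key
  exact (ENNReal.ofReal_le_ofReal_iff (mul_nonneg (Real.rpow_nonneg (integral_nonneg_of_ae nA) _)
    (Real.rpow_nonneg (integral_nonneg_of_ae nB) _))).1 key

lemma aux_pt (f : SchwartzMap EE ℂ) (m ξ : EE) :
    ‖𝓕 (LineDeriv.lineDerivOp m f : SchwartzMap EE ℂ) ξ‖ ^ 2
      = (2 * Real.pi) ^ 2 * ((inner ℝ ξ m) ^ 2 * ‖(𝓕 f) ξ‖ ^ 2) := by
  have : (fun x : EE => (inner ℝ x m : ℝ)).HasTemperateGrowth :=
    ((innerSL ℝ).flip m).hasTemperateGrowth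
  rw [SchwartzMap.fourier_lineDerivOp_eq]
  simp only [_root_.smul_apply, SchwartzMap.smulLeftCLM_apply_apply this, norm_smul, norm_mul,
    mul_pow, Real.norm_eq_abs, sq_abs]
  simp [mul_assoc]

lemma aux_B (f : SchwartzMap EE ℂ) :
    Integrable (fun ξ : EE => ‖ξ‖ ^ 2 * ‖(𝓕 f) ξ‖ ^ 2) ∧
    ∫ ξ : EE, ‖ξ‖ ^ 2 * ‖(𝓕 f) ξ‖ ^ 2 ≤ ∫ x, ‖fderiv ℝ f x‖ ^ 2 := by
  let e : Fin 2 → EE := fun i => EuclideanSpace.single i 1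
  let h : Fin 2 → SchwartzMap EE ℂ := fun i => LineDeriv.lineDerivOp (e i) f
  have hpt : (fun ξ : EE => ‖ξ‖ ^ 2 * ‖(𝓕 f) ξ‖ ^ 2) =
      fun ξ => ((2 * Real.pi) ^ 2)⁻¹ * (‖𝓕 (h 0) ξ‖ ^ 2 + ‖𝓕 (h 1) ξ‖ ^ 2) := by
    funext ξ
    simp only [h, aux_pt, e]
    rw [EuclideanSpace.real_norm_sq_eq]
    have := Real.pi_pos
    simp [Fin.sum_univ_two, EuclideanSpace.inner_single_right]
    field_simp
  have hd : Integrable (fun x => ‖fderiv ℝ f x‖ ^ 2) := aux_sq_int (fderivCLM ℝ EE ℂ f)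
  have hle : ∀ i, ∫ x, ‖h i x‖ ^ 2 ≤ ∫ x, ‖fderiv ℝ f x‖ ^ 2 := by
    intro i
    refine integral_mono (aux_sq_int _) hd fun x => ?_
    simp only [h, SchwartzMap.lineDerivOp_apply_eq_fderiv]
    have := (fderiv ℝ f x).le_opNorm (e i)
    have he : ‖e i‖ = 1 := by simp [e]
    rw [he, mul_one] at this
    gcongr
  rw [hpt]
  refine ⟨((aux_sq_int _).add (aux_sq_int _)).const_mul _, ?_⟩
  rw [integral_const_mul, integral_add (aux_sq_int _) (aux_sq_int _),
    SchwartzMap.integral_norm_sq_fourier, SchwartzMap.integral_norm_sq_fourier]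
  have hD : 0 ≤ ∫ x, ‖fderiv ℝ f x‖ ^ 2 := integral_nonneg fun x => by positivity
  rw [inv_mul_le_iff₀ (by positivity)]
  nlinarith [hle 0, hle 1, Real.pi_gt_three, mul_nonneg hD Real.pi_pos.le]

lemma aux_norm {F : Type*} [NormedAddCommGroup F] [NormedSpace ℝ F] (g : SchwartzMap EE F) :
    (eLpNorm g 2 volume).toReal = (∫ x, ‖g x‖ ^ 2) ^ ((1:ℝ)/2) := by
  rw [(g.memLp 2 volume).eLpNorm_eq_integral_rpow_norm (by simp) (by simp), ENNReal.toReal_ofReal]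
  · simp
  · exact Real.rpow_nonneg (integral_nonneg fun x => by positivity) _

lemma aux_deriv (f : SchwartzMap EE ℂ) :
    derivL2Norm 1 f = (∫ x, ‖fderiv ℝ f x‖ ^ 2) ^ ((1:ℝ)/2) := by
  have := aux_norm (fderivCLM ℝ EE ℂ f)
  simp only [fderivCLM_apply] at this
  rw [← this, derivL2Norm]
  congr 1
  refine eLpNorm_congr_norm_ae (ae_of_all _ fun x => ?_)
  rw [norm_iteratedFDeriv_one]
  rfl

/-- Interpolation: `‖f‖_{L²} ≲ ‖Λ^{-s}f‖_{L²}^{1/(1+s)} ‖∇f‖_{L²}^{s/(1+s)}`. -/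
theorem stmt10 :
    ∀ s : ℝ, 0 < s → s < 1 →
    ∃ C > (0 : ℝ), ∀ f : SchwartzMap (EuclideanSpace ℝ (Fin 2)) ℂ,
      (eLpNorm (⇑f) 2 volume).toReal ≤ C * negSobNorm s f ^ (1/(1+s)) *
        derivL2Norm 1 f ^ (s/(1+s)) := by
  intro s h0 h1
  refine ⟨1, one_pos, fun f => ?_⟩
  obtain ⟨hB, hBD⟩ := aux_B f
  have key := aux_hol s h0 h1 (𝓕 f) hB
  rw [SchwartzMap.integral_norm_sq_fourier, SchwartzMap.fourier_coe] at key
  rw [SchwartzMap.fourier_coe] at hBD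
  rw [aux_norm, aux_deriv, negSobNorm, one_mul]
  have hA0 : 0 ≤ ∫ ξ : EE, ‖ξ‖ ^ (-(2*s)) * ‖𝓕 (⇑f) ξ‖ ^ 2 :=
    integral_nonneg fun x => by positivity
  have hB0 : 0 ≤ ∫ ξ : EE, ‖ξ‖ ^ 2 * ‖𝓕 (⇑f) ξ‖ ^ 2 :=
    integral_nonneg fun x => by positivity
  have hf0 : 0 ≤ ∫ x, ‖f x‖ ^ 2 := integral_nonneg fun x => by positivity
  have hD0 := hB0.trans hBD
  rw [← Real.rpow_mul hA0, ← Real.rpow_mul hD0, mul_comm ((1:ℝ)/2), mul_comm ((1:ℝ)/2),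
    Real.rpow_mul hA0, Real.rpow_mul hD0, ← Real.mul_rpow (by positivity) (by positivity)]
  refine Real.rpow_le_rpow hf0 (key.trans ?_) (by norm_num)
  gcongr
end
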